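/- arXiv:1107.4715 — 6 statements merged into one kernel-verified Lean document; each statement's English description precedes it below -/
import Mathlib

section
/- Let ℓ ≥ 2 be an integer, let k ≥ 4ℓ + 1 be an odd integer, and let c > 0 be a real number. If G is a graph on n ≥ 1 vertices that contains no cycle of length 2m for any 2 ≤ m ≤ ℓ, contains no cycle of length k, and in which every vertex has degree at least c·n^{1/ℓ}, then the chromatic number of G satisfies χ(G) < (4k)^{ℓ+1}/c^ℓ. -/
open SimpleGraph

/-- `G` contains a cycle of length `m` (as a subgraph). -/
def HasCycleLength {V : Type*} (G : SimpleGraph V) (m : ℕ) : Prop :=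
  ∃ (v : V) (w : G.Walk v v), w.IsCycle ∧ w.length = m

/-- `G` is `𝓒_{2ℓ}`-free: it contains no cycle of length `2m` for any `2 ≤ m ≤ ℓ`. -/
def EvenCycleFree {V : Type*} (G : SimpleGraph V) (ℓ : ℕ) : Prop :=
  ∀ m, 2 ≤ m → m ≤ ℓ → ¬ HasCycleLength G (2 * m)

/-- close up a path at the top using parents -/
lemma cycle_of_tree {V : Type*} (G : SimpleGraph V) (lev : V → ℕ) (par : V → V)
    (hpar : ∀ x, lev x ≠ 0 → G.Adj x (par x) ∧ lev (par x) + 1 = lev x) (t : ℕ) :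
    ∀ (i : ℕ) (x y : V) (p : G.Walk x y), p.IsPath → lev x = i → lev y = i →
      t + 1 ≤ i → par^[t+1] x = par^[t+1] y → par^[t] x ≠ par^[t] y →
      (∀ z ∈ p.support, i ≤ lev z) → HasCycleLength G (p.length + 2 * (t + 1)) := by
  induction t with
  | zero =>
    intro i x y p hp hx hy hi h1 h0 hs
    simp only [zero_add, Function.iterate_one, Function.iterate_zero, id] at h1 h0
    obtain ⟨ax, lx⟩ := hpar x (by omega)
    obtain ⟨ay, ly⟩ := hpar y (by omega)
    have hz : par y ∉ p.support := fun h => by have := hs _ h; omega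
    have hq : (p.concat ay).IsPath := hp.concat hz ay
    have ax' : G.Adj (par y) x := by rw [← h1]; exact ax.symm
    refine ⟨par y, Walk.cons ax' (p.concat ay), ?_, by simp⟩
    rw [Walk.cons_isCycle_iff]
    refine ⟨hq, ?_⟩
    rw [Walk.edges_concat]
    simp only [List.concat_eq_append, List.mem_append, List.mem_singleton, not_or]
    refine ⟨fun h => hz (Walk.fst_mem_support_of_mem_edges _ h), ?_⟩
    intro h
    rw [Sym2.eq_iff] at h
    rcases h with ⟨h, h'⟩ | ⟨h, h'⟩
    · exact ay.ne h.symm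
    · exact h0 h'
  | succ t ih =>
    intro i x y p hp hx hy hi h1 h0 hs
    obtain ⟨ax, lx⟩ := hpar x (by omega)
    obtain ⟨ay, ly⟩ := hpar y (by omega)
    have hz : par y ∉ p.support := fun h => by have := hs _ h; omega
    have hzx : par x ∉ p.support := fun h => by have := hs _ h; omega
    have hq : (p.concat ay).IsPath := hp.concat hz ay
    have hne : par x ≠ par y := by
      intro h
      apply h0
      rw [Function.iterate_succ_apply, Function.iterate_succ_apply, h]
    have hr : (Walk.cons ax.symm (p.concat ay)).IsPath := by
      rw [Walk.cons_isPath_iff]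
      refine ⟨hq, ?_⟩
      rw [Walk.support_concat]
      simp only [List.concat_eq_append, List.mem_append, List.mem_singleton, not_or]
      exact ⟨hzx, hne⟩
    have := ih (i - 1) (par x) (par y) _ hr (by omega) (by omega) (by omega)
      (by simpa only [Function.iterate_succ_apply] using h1)
      (by simpa only [Function.iterate_succ_apply] using h0)
      (by
        intro z hz
        simp only [Walk.support_cons, Walk.support_concat, List.concat_eq_append, List.mem_cons,
          List.mem_append, List.not_mem_nil, or_false] at hz
        rcases hz with rfl | hz | rfl
        · omega
        · have := hs z hz; omega
        · omega)
    have e : (Walk.cons ax.symm (p.concat ay)).length + 2 * (t + 1)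
        = p.length + 2 * (t + 1 + 1) := by
      simp; ring
    rwa [e] at this

open Classical in
lemma exists_path_avoid {V : Type*} (G : SimpleGraph V) (S : Finset V) (D : ℕ)
    (hD : ∀ v ∈ S, D ≤ (S.filter (fun w => G.Adj v w)).card) (s : ℕ) :
    ∀ (F : Finset V) (v : V), v ∈ S → v ∉ F → F.card + s ≤ D →
      ∃ (z : V) (p : G.Walk v z), p.IsPath ∧ p.length = s ∧ ∀ u ∈ p.support, u ∈ S ∧ u ∉ F := by
  induction s with
  | zero =>
    intro F v hv hF _
    exact ⟨v, Walk.nil, Walk.IsPath.nil, rfl, by simp [hv, hF]⟩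
  | succ s ih =>
    intro F v hv hF hc
    have : ∃ w ∈ S.filter (fun w => G.Adj v w), w ∉ F := by
      apply Finset.exists_mem_notMem_of_card_lt_card
      have := hD v hv
      omega
    obtain ⟨w, hw, hwF⟩ := this
    rw [Finset.mem_filter] at hw
    obtain ⟨z, p, hp, hl, hs⟩ := ih (insert v F) w hw.1
      (by simp [hwF, hw.2.ne']) (by have := Finset.card_insert_le v F; omega)
    refine ⟨z, Walk.cons hw.2 p, ?_, by simp [hl], ?_⟩
    · rw [Walk.cons_isPath_iff]
      refine ⟨hp, fun h => ?_⟩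
      have := (hs v h).2
      simp at this
    · intro u hu
      rw [Walk.support_cons, List.mem_cons] at hu
      rcases hu with rfl | hu
      · exact ⟨hv, hF⟩
      · have := hs u hu
        exact ⟨this.1, fun h => this.2 (Finset.mem_insert_of_mem h)⟩

/-- proper coloring of a set -/
def ColS {V : Type*} (G : SimpleGraph V) (S : Finset V) (q : ℕ) : Prop :=
  ∃ f : V → Fin q, ∀ x ∈ S, ∀ y ∈ S, G.Adj x y → f x ≠ f y

open Classical in
lemma level_color {V : Type*} [Fintype V] (G : SimpleGraph V) (lev : V → ℕ) (par : V → V)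
    (hpar : ∀ x, lev x ≠ 0 → G.Adj x (par x) ∧ lev (par x) + 1 = lev x)
    (k i : ℕ) (hk : 2 * i + 1 ≤ k) (hfk : ¬ HasCycleLength G k) (r : V) (S : Finset V) :
    (∀ x ∈ S, lev x = i ∧ par^[i] x = r) → ColS G S (k + 2) := by
  induction S using Finset.strongInduction with
  | H S IH =>
  intro hS
  by_contra hcon
  have hdeg : ∀ v ∈ S, k + 2 ≤ (S.filter (fun w => G.Adj v w)).card := by
    intro v hv
    by_contra hlt
    push Not at hlt
    obtain ⟨f, hf⟩ := IH (S.erase v) (Finset.erase_ssubset hv)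
      (fun x hx => hS x (Finset.mem_of_mem_erase hx))
    have : ∃ a : Fin (k+2), a ∉ (S.filter (fun w => G.Adj v w)).image f := by
      by_contra hall
      push Not at hall
      have h1 : (Finset.univ : Finset (Fin (k+2))) ⊆ (S.filter (fun w => G.Adj v w)).image f :=
        fun a _ => hall a
      have h2 := Finset.card_le_card h1
      have h3 : ((S.filter (fun w => G.Adj v w)).image f).card ≤ _ := Finset.card_image_le
      rw [Finset.card_univ, Fintype.card_fin] at h2
      omega
    obtain ⟨a, ha⟩ := this
    have ha' : ∀ w ∈ S, G.Adj v w → f w ≠ a := by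
      intro w hw hvw h
      exact ha (Finset.mem_image.2 ⟨w, Finset.mem_filter.2 ⟨hw, hvw⟩, h⟩)
    apply hcon
    refine ⟨fun x => if x = v then a else f x, ?_⟩
    intro x hx y hy hxy
    by_cases h1 : x = v
    · subst h1
      have : y ≠ x := hxy.ne'
      simp only [if_true, this, if_false]
      exact (ha' y hy hxy).symm
    · by_cases h2 : y = v
      · subst h2
        simp only [h1, if_true, if_false]
        exact ha' x hx hxy.symm
      · simp only [h1, h2, if_false]
        exact hf x (Finset.mem_erase.2 ⟨h1, hx⟩) y (Finset.mem_erase.2 ⟨h2, hy⟩) hxy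
  have hex : ∃ t, ∀ x ∈ S, ∀ y ∈ S, par^[t] x = par^[t] y :=
    ⟨i, fun x hx y hy => by rw [(hS x hx).2, (hS y hy).2]⟩
  have hti : Nat.find hex ≤ i :=
    Nat.find_le (h := hex) (fun x hx y hy => by rw [(hS x hx).2, (hS y hy).2])
  have htspec := Nat.find_spec hex
  rcases ht : Nat.find hex with _ | t
  · rw [ht] at htspec
    apply hcon
    exact ⟨fun _ => 0, fun x hx y hy hxy => absurd (htspec x hx y hy) hxy.ne⟩
  have hnc := Nat.find_min hex (m := t) (by omega)
  rw [ht] at htspec hti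
  set P : V → V := par^[t] with hP
  -- no crossing path
  have hcross : ∀ (x y : V) (p : G.Walk x y), p.IsPath → p.length = k - 2 * (t + 1) →
      (∀ u ∈ p.support, u ∈ S) → P x = P y := by
    intro x y p hp hl hs
    by_contra hne
    have hx := hs x p.start_mem_support
    have hy := hs y p.end_mem_support
    have := cycle_of_tree G lev par hpar t i x y p hp (hS x hx).1 (hS y hy).1 hti
      (htspec x hx y hy) hne (fun z hz => (hS z (hs z hz)).1.ge)
    rw [hl] at this
    apply hfk
    convert this using 1
    omega
  have hsame : ∀ v ∈ S, ∀ w ∈ S, ∀ w' ∈ S, G.Adj v w → G.Adj v w' → P w = P w' := by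
    intro v hv w hw w' hw' h h'
    obtain ⟨z, p, hp, hl, hs⟩ := exists_path_avoid G S (k+2) hdeg (k - 2 * (t+1) - 1) {w, w'} v hv
      (by simp [h.ne, h'.ne]) (by have := Finset.card_le_two (a := w) (b := w'); omega)
    have key : ∀ a ∈ ({w, w'} : Finset V), a ∈ S → G.Adj v a → P a = P z := by
      intro a haF haS hva
      apply hcross a z (Walk.cons hva.symm p)
      · rw [Walk.cons_isPath_iff]
        exact ⟨hp, fun h => (hs a h).2 haF⟩
      · rw [Walk.length_cons, hl]; omega
      · intro u hu
        rw [Walk.support_cons, List.mem_cons] at hu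
        rcases hu with rfl | hu
        · exact haS
        · exact (hs u hu).1
    rw [key w (by simp) hw h, key w' (by simp) hw' h']
  have hparts : ∀ a : V, ∃ f : V → Fin (k+2), ∀ x ∈ S, ∀ y ∈ S, P x = a → P y = a →
      G.Adj x y → f x ≠ f y := by
    intro a
    obtain ⟨f, hf⟩ := IH (S.filter (fun x => P x = a)) (by
      rw [Finset.filter_ssubset]
      by_contra hh
      push Not at hh
      exact hnc (fun x hx y hy => by rw [hh x hx, hh y hy]))
      (fun x hx => hS x (Finset.mem_filter.1 hx).1)
    exact ⟨f, fun x hx y hy h1 h2 => hf x (Finset.mem_filter.2 ⟨hx, h1⟩) y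
      (Finset.mem_filter.2 ⟨hy, h2⟩)⟩
  choose f hf using hparts
  have hM : ∀ v, ∃ b, ∀ w ∈ S, v ∈ S → G.Adj v w → P w = b := by
    intro v
    by_cases h : ∃ w ∈ S, v ∈ S ∧ G.Adj v w
    · obtain ⟨w, hw, hv, hvw⟩ := h
      exact ⟨P w, fun w' hw' _ h' => hsame v hv w' hw' w hw h' hvw⟩
    · exact ⟨v, fun w hw hv hvw => absurd ⟨w, hw, hv, hvw⟩ h⟩
  choose M hM using hM
  let e := Fintype.equivFin V
  apply hcon
  refine ⟨fun v => if P v = M v then f (P v) v else if e (P v) < e (M v) then 0 else 1, ?_⟩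
  intro x hx y hy hxy
  have h1 : P y = M x := hM x y hy hx hxy
  have h2 : P x = M y := hM y x hx hy hxy.symm
  simp only [← h1, ← h2]
  by_cases h : P x = P y
  · simp only [h, if_true]
    exact hf (P y) x hx y hy h rfl hxy
  · have h' : ¬ P y = P x := fun hh => h hh.symm
    simp only [h, h', if_false]
    have hne : e (P x) ≠ e (P y) := fun hh => h (e.injective hh)
    rcases lt_or_gt_of_ne hne with hlt | hlt
    · simp [hlt, hlt.not_gt]
    · simp [hlt, hlt.not_gt]

lemma exists_par {V : Type*} (G : SimpleGraph V) (r : V) : ∃ par : V → V,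
    (∀ x, G.dist r x ≠ 0 → G.Adj x (par x) ∧ G.dist r (par x) + 1 = G.dist r x) ∧
    ∀ i x, G.Reachable r x → G.dist r x = i → par^[i] x = r := by
  have : ∀ x, ∃ y, G.dist r x ≠ 0 → G.Adj x y ∧ G.dist r y + 1 = G.dist r x := by
    intro x
    by_cases h : G.dist r x = 0
    · exact ⟨x, fun h' => absurd h h'⟩
    have hr : G.Reachable x r := (Reachable.of_dist_ne_zero h).symm
    obtain ⟨p, hp⟩ := hr.exists_walk_length_eq_dist
    rw [dist_comm] at hp
    cases p with
    | nil => simp at h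
    | cons hxy p =>
      rename_i y
      refine ⟨y, fun _ => ⟨hxy, ?_⟩⟩
      rw [Walk.length_cons] at hp
      have h1 : G.dist r y ≤ p.length := by rw [dist_comm]; exact dist_le p
      obtain ⟨p', hp'⟩ := p.reachable.exists_walk_length_eq_dist
      have h2 := dist_le (Walk.cons hxy p')
      rw [Walk.length_cons, hp', dist_comm, dist_comm (u := y)] at h2
      omega
  choose par hpar using this
  refine ⟨par, hpar, ?_⟩
  intro i
  induction i with
  | zero =>
    intro x hx h
    exact ((hx.dist_eq_zero_iff).1 h).symm
  | succ i ih =>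
    intro x hx h
    obtain ⟨h1, h2⟩ := hpar x (by omega)
    rw [Function.iterate_succ_apply]
    exact ih _ (hx.trans h1.reachable) (by omega)

/-- two vertices of the same level have no common neighbour at the same or a higher level -/
lemma no_common {V : Type*} (G : SimpleGraph V) (ℓ : ℕ) (hfree : EvenCycleFree G ℓ) (r : V)
    (i : ℕ) (hi : i + 1 ≤ ℓ) (x y u : V) (hx : G.dist r x = i) (hy : G.dist r y = i)
    (rx : G.Reachable r x) (ry : G.Reachable r y)
    (hxy : x ≠ y) (hu : i ≤ G.dist r u) (hux : G.Adj u x) (huy : G.Adj u y) : False := by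
  classical
  obtain ⟨par, hpar, hroot⟩ := exists_par G r
  have hex : ∃ t, par^[t] x = par^[t] y := ⟨i, by rw [hroot i x rx hx, hroot i y ry hy]⟩
  have hti : Nat.find hex ≤ i :=
    Nat.find_le (h := hex) (by rw [hroot i x rx hx, hroot i y ry hy])
  have htspec := Nat.find_spec hex
  rcases ht : Nat.find hex with _ | t
  · rw [ht] at htspec
    exact hxy htspec
  have hnc := Nat.find_min hex (m := t) (by omega)
  rw [ht] at htspec hti
  have := cycle_of_tree G (G.dist r) par hpar t i x y (Walk.cons hux.symm (Walk.cons huy Walk.nil))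
    (by simp [Walk.cons_isPath_iff, hux.ne', huy.ne, hxy]) hx hy hti htspec hnc
    (by
      intro z hz
      simp only [Walk.support_cons, Walk.support_nil, List.mem_cons, List.not_mem_nil,
        or_false] at hz
      rcases hz with rfl | rfl | rfl <;> omega)
  refine hfree (t + 2) (by omega) (by omega) ?_
  convert this using 1
  simp; ring

open Classical in
/-- sphere -/
noncomputable def sph {V : Type*} [Fintype V] (G : SimpleGraph V) (r : V) (i : ℕ) : Finset V :=
  Finset.univ.filter (fun x => G.Reachable r x ∧ G.dist r x = i)

lemma mem_sph {V : Type*} [Fintype V] (G : SimpleGraph V) (r : V) (i : ℕ) (x : V) :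
    x ∈ sph G r i ↔ G.Reachable r x ∧ G.dist r x = i := by simp [sph]

open Classical in
lemma sph_grow {V : Type*} [Fintype V] (G : SimpleGraph V) (ℓ d : ℕ) (hfree : EvenCycleFree G ℓ)
    (hd : ∀ v, d + 2 ≤ (Finset.univ.filter (fun w => G.Adj v w)).card) (r : V) (i : ℕ) :
    i ≤ ℓ → d ^ i ≤ (sph G r i).card := by
  induction i with
  | zero =>
    intro _
    rw [pow_zero, Nat.one_le_iff_ne_zero, ← Nat.pos_iff_ne_zero, Finset.card_pos]
    exact ⟨r, by simp [mem_sph]⟩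
  | succ i ih =>
    intro hi
    have h1 : ∀ u ∈ sph G r i, d ≤ ((sph G r (i+1)).filter (fun w => G.Adj u w)).card := by
      intro u hu
      rw [mem_sph] at hu
      have hsub : Finset.univ.filter (fun w => G.Adj u w) ⊆
          ((sph G r (i+1)).filter (fun w => G.Adj u w)) ∪
          ((Finset.univ.filter (fun w => G.Adj u w ∧ G.dist r w = i)) ∪
          (Finset.univ.filter (fun w => G.Adj u w ∧ G.dist r w + 1 = i))) := by
        intro w hw
        simp only [Finset.mem_filter, Finset.mem_univ, true_and, Finset.mem_union, mem_sph] at hw ⊢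
        have hrw : G.Reachable r w := hu.1.trans hw.reachable
        have e1 : G.dist r w ≤ G.dist r u + 1 := by
          obtain ⟨p, hp⟩ := hu.1.exists_walk_length_eq_dist
          have := dist_le (p.concat hw)
          rwa [Walk.length_concat, hp] at this
        have e2 : G.dist r u ≤ G.dist r w + 1 := by
          obtain ⟨p, hp⟩ := hrw.exists_walk_length_eq_dist
          have := dist_le (p.concat hw.symm)
          rwa [Walk.length_concat, hp] at this
        have : G.dist r w = i + 1 ∨ G.dist r w = i ∨ G.dist r w + 1 = i := by omega
        tauto
      have c1 : (Finset.univ.filter (fun w => G.Adj u w ∧ G.dist r w = i)).card ≤ 1 := by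
        rw [Finset.card_le_one]
        intro a ha b hb
        simp only [Finset.mem_filter, Finset.mem_univ, true_and] at ha hb
        by_contra hab
        exact no_common G ℓ hfree r i hi a b u ha.2 hb.2 (hu.1.trans ha.1.reachable)
          (hu.1.trans hb.1.reachable) hab hu.2.ge ha.1 hb.1
      have c2 : (Finset.univ.filter (fun w => G.Adj u w ∧ G.dist r w + 1 = i)).card ≤ 1 := by
        rw [Finset.card_le_one]
        intro a ha b hb
        simp only [Finset.mem_filter, Finset.mem_univ, true_and] at ha hb
        by_contra hab
        exact no_common G ℓ hfree r (i-1) (by omega) a b u (by omega) (by omega)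
          (hu.1.trans ha.1.reachable)
          (hu.1.trans hb.1.reachable) hab (by omega) ha.1 hb.1
      have := (Finset.card_le_card hsub).trans
        ((Finset.card_union_le _ _).trans (Nat.add_le_add_left (Finset.card_union_le _ _) _))
      have := hd u
      omega
    have hdisj : ((sph G r i : Finset V) : Set V).PairwiseDisjoint
        (fun u => (sph G r (i+1)).filter (fun w => G.Adj u w)) := by
      intro a ha b hb hab
      rw [Function.onFun, Finset.disjoint_left]
      intro w hwa hwb
      rw [Finset.mem_coe, mem_sph] at ha hb
      rw [Finset.mem_filter, mem_sph] at hwa hwb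
      exact no_common G ℓ hfree r i hi a b w ha.2 hb.2 ha.1 hb.1 hab (by omega) hwa.2.symm hwb.2.symm
    have hsub : (sph G r i).biUnion (fun u => (sph G r (i+1)).filter (fun w => G.Adj u w))
        ⊆ sph G r (i+1) := by
      intro w hw
      rw [Finset.mem_biUnion] at hw
      obtain ⟨u, _, h⟩ := hw
      exact (Finset.mem_filter.1 h).1
    have h2 := Finset.card_le_card hsub
    rw [Finset.card_biUnion hdisj] at h2
    have h3 := Finset.card_nsmul_le_sum _ _ _ h1
    calc d ^ (i+1) = d^i * d := pow_succ _ _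
      _ ≤ (sph G r i).card * d := Nat.mul_le_mul_right _ (ih (by omega))
      _ ≤ _ := by rw [smul_eq_mul] at h3; exact h3.trans h2

open Classical in
lemma exists_centers {V : Type*} [Fintype V] (B : V → Finset V) (hB : ∀ v, (B v).Nonempty) :
    ∃ C : Finset V, (C : Set V).PairwiseDisjoint B ∧ ∀ u, ∃ v ∈ C, ¬ Disjoint (B u) (B v) := by
  obtain ⟨C, hC, hmax⟩ := Finset.exists_max_image
    (Finset.univ.filter (fun C : Finset V => (C : Set V).PairwiseDisjoint B)) Finset.card
    ⟨∅, by simp⟩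
  simp only [Finset.mem_filter, Finset.mem_univ, true_and] at hC hmax
  refine ⟨C, hC, fun u => ?_⟩
  by_contra hcon
  push Not at hcon
  have hu : u ∉ C := by
    intro h
    have := hcon u h
    rw [disjoint_self] at this
    exact (hB u).ne_empty this
  have := hmax (insert u C) (by
    rw [Finset.coe_insert]
    exact hC.insert (fun j hj _ => hcon j hj))
  rw [Finset.card_insert_of_notMem hu] at this
  omega

lemma color_all {V : Type*} [Fintype V] (G : SimpleGraph V) (ℓ k : ℕ)
    (hk4 : 4 * ℓ + 1 ≤ k) (hfk : ¬ HasCycleLength G k) (C : Finset V)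
    (hC : ∀ u, ∃ v ∈ C, ¬ Disjoint (sph G u ℓ) (sph G v ℓ)) :
    G.Colorable (C.card * (2 * ℓ + 1) * (k + 2)) := by
  classical
  have h1 : ∀ u, ∃ v : C, G.Reachable v u ∧ G.dist v u < 2 * ℓ + 1 := by
    intro u
    obtain ⟨v, hv, h⟩ := hC u
    rw [Finset.not_disjoint_iff] at h
    obtain ⟨z, hz1, hz2⟩ := h
    rw [mem_sph] at hz1 hz2
    refine ⟨⟨v, hv⟩, hz2.1.trans hz1.1.symm, ?_⟩
    obtain ⟨p, hp⟩ := hz2.1.exists_walk_length_eq_dist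
    obtain ⟨p', hp'⟩ := hz1.1.exists_walk_length_eq_dist
    have := dist_le (p.append p'.reverse)
    rw [Walk.length_append, Walk.length_reverse] at this
    show G.dist v u < _
    omega
  choose cen hcr hcd using h1
  have h2 : ∀ (v : C) (i : Fin (2 * ℓ + 1)), ∃ f : V → Fin (k+2),
      ∀ x ∈ sph G v i, ∀ y ∈ sph G v i, G.Adj x y → f x ≠ f y := by
    intro v i
    obtain ⟨par, hpar, hroot⟩ := exists_par G (v : V)
    exact level_color G (G.dist v) par hpar k i (by omega) hfk v (sph G v i)
      (fun x hx => by rw [mem_sph] at hx; exact ⟨hx.2, hroot _ x hx.1 hx.2⟩)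
  choose f hf using h2
  have h3 : ∀ u, ∃ i : Fin (2 * ℓ + 1), u ∈ sph G (cen u) i :=
    fun u => ⟨⟨_, hcd u⟩, by rw [mem_sph]; exact ⟨hcr u, rfl⟩⟩
  choose lv hlv using h3
  let col : G.Coloring (C × Fin (2 * ℓ + 1) × Fin (k+2)) :=
    Coloring.mk (fun u => (cen u, lv u, f (cen u) (lv u) u))
    (by
      intro x y hxy h
      simp only [Prod.mk.injEq] at h
      obtain ⟨e1, e2, e3⟩ := h
      have hy := hlv y
      rw [← e1, ← e2] at hy e3
      exact hf (cen x) (lv x) x (hlv x) y hy hxy e3)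
  have := col.colorable
  simpa [Fintype.card_prod, mul_assoc] using this

theorem chromatic_number_bound (ℓ k : ℕ) (hℓ : 2 ≤ ℓ) (hk : Odd k)
    (hk4 : 4 * ℓ + 1 ≤ k) (c : ℝ) (hc : 0 < c)
    {V : Type*} [Fintype V] (G : SimpleGraph V) (hn : 1 ≤ Fintype.card V)
    (hfree : EvenCycleFree G ℓ) (hfk : ¬ HasCycleLength G k)
    (hdeg : ∀ v : V, c * (Fintype.card V : ℝ) ^ ((1 : ℝ) / ℓ) ≤ ((G.neighborSet v).ncard : ℝ)) :
    ∃ m : ℕ, G.Colorable m ∧ (m : ℝ) < (4 * (k : ℝ)) ^ (ℓ + 1) / c ^ ℓ := by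
  classical
  set n := Fintype.card V with hn'
  have hn0 : (0:ℝ) < n := by exact_mod_cast hn
  set x : ℝ := c * (n : ℝ) ^ ((1 : ℝ) / ℓ) with hx
  have hxpow : x ^ ℓ = c ^ ℓ * n := by
    rw [hx, mul_pow, ← Real.rpow_natCast ((n:ℝ) ^ ((1 : ℝ) / ℓ)), ← Real.rpow_mul hn0.le]
    rw [one_div, inv_mul_cancel₀ (by positivity), Real.rpow_one]
  have hx0 : 0 < x := by positivity
  have hcl : 0 < c ^ ℓ := by positivity
  have hk1 : (9:ℝ) ≤ k := by exact_mod_cast (by omega : 9 ≤ k)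
  by_cases hx6 : x < 6
  · refine ⟨n, G.colorable_of_fintype, ?_⟩
    rw [lt_div_iff₀ hcl, mul_comm, ← hxpow]
    calc x ^ ℓ < 6 ^ ℓ := pow_lt_pow_left₀ hx6 hx0.le (by omega)
      _ ≤ (4 * (k:ℝ)) ^ ℓ := by gcongr; linarith
      _ ≤ (4 * (k:ℝ)) ^ (ℓ + 1) := pow_le_pow_right₀ (by linarith) (by omega)
  push Not at hx6
  -- natural lower bound on degrees
  obtain ⟨d, hd⟩ : ∃ d : ℕ, ⌈x⌉₊ = d + 2 := by
    have : 2 ≤ ⌈x⌉₊ := by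
      have := Nat.le_ceil x
      exact_mod_cast (by linarith : (2:ℝ) ≤ ⌈x⌉₊)
    exact ⟨⌈x⌉₊ - 2, by omega⟩
  have hdx : x / 2 ≤ d := by
    have := Nat.le_ceil x
    rw [hd] at this
    push_cast at this
    linarith
  have hdeg' : ∀ v, d + 2 ≤ (Finset.univ.filter (fun w => G.Adj v w)).card := by
    intro v
    rw [← hd]
    apply Nat.ceil_le.2
    have e : (G.neighborSet v).ncard = (Finset.univ.filter (fun w => G.Adj v w)).card := by
      rw [← Set.ncard_coe_finset]
      congr 1
      ext w
      simp
    rw [← e]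
    exact hdeg v
  have hgrow : ∀ v, d ^ ℓ ≤ (sph G v ℓ).card := fun v => sph_grow G ℓ d hfree hdeg' v ℓ le_rfl
  have hdpos : 0 < d := by
    have : (0:ℝ) < d := by linarith
    exact_mod_cast this
  obtain ⟨C, hC1, hC2⟩ := exists_centers (fun v => sph G v ℓ)
    (fun v => Finset.card_pos.1 (lt_of_lt_of_le (by positivity) (hgrow v)))
  have hcard : C.card * d ^ ℓ ≤ n := by
    have h1 := Finset.card_nsmul_le_sum C (fun v => (sph G v ℓ).card) _ (fun v _ => hgrow v)
    rw [← Finset.card_biUnion hC1, smul_eq_mul] at h1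
    exact h1.trans (Finset.card_le_univ _)
  refine ⟨_, color_all G ℓ k hk4 hfk C hC2, ?_⟩
  rw [lt_div_iff₀ hcl]
  have hCc : (C.card : ℝ) * c ^ ℓ ≤ 2 ^ ℓ := by
    have h1 : (C.card : ℝ) * (d:ℝ) ^ ℓ ≤ n := by exact_mod_cast hcard
    have h2 : (C.card : ℝ) * (x / 2) ^ ℓ ≤ n := le_trans (by gcongr) h1
    rw [div_pow, hxpow] at h2
    have h3 : ((C.card : ℝ) * c ^ ℓ / 2 ^ ℓ) * n ≤ 1 * n := by
      calc _ = (C.card : ℝ) * (c ^ ℓ * n / 2 ^ ℓ) := by ring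
        _ ≤ _ := by linarith
    have h4 := le_of_mul_le_mul_right h3 hn0
    rwa [div_le_one (by positivity)] at h4
  have hlk : (2 * (ℓ:ℝ) + 1) ≤ k := by exact_mod_cast (by omega : 2 * ℓ + 1 ≤ k)
  push_cast
  have hpow : (2:ℝ) ^ ℓ * k < (4 * (k:ℝ)) ^ ℓ := by
    rw [show (4 * (k:ℝ)) = 2 * (2 * k) by ring, mul_pow]
    have : (k:ℝ) < (2 * (k:ℝ)) ^ ℓ := by
      calc (k:ℝ) < (2 * (k:ℝ)) ^ 1 := by linarith
        _ ≤ _ := pow_le_pow_right₀ (by linarith) (by omega)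
    gcongr
  calc (C.card : ℝ) * (2 * ℓ + 1) * (k + 2) * c ^ ℓ
      = ((C.card : ℝ) * c ^ ℓ) * (2 * ℓ + 1) * (k + 2) := by ring
    _ ≤ 2 ^ ℓ * k * (4 * k) := by gcongr; linarith
    _ < (4 * (k:ℝ)) ^ ℓ * (4 * k) := by gcongr
    _ = _ := (pow_succ _ _).symm
end

section
/- Let ℓ ≥ 3 be an integer and let k be an odd integer with 5 ≤ k < 2ℓ. Then for every n ≥ 3, ex(n, 𝓒_{2ℓ} ∪ {C_k}) ≥ z(n, 𝓒_{2ℓ}) + 1. -/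
open SimpleGraph

/-- `ex(n, 𝓒_{2ℓ} ∪ {C_k})`. -/
noncomputable def exTuran (n ℓ k : ℕ) : ℕ :=
  sSup {e | ∃ G : SimpleGraph (Fin n),
    EvenCycleFree G ℓ ∧ ¬ HasCycleLength G k ∧ G.edgeSet.ncard = e}

/-- `z(n, 𝓒_{2ℓ})`. -/
noncomputable def zZar (n ℓ : ℕ) : ℕ :=
  sSup {e | ∃ G : SimpleGraph (Fin n),
    EvenCycleFree G ℓ ∧ G.Colorable 2 ∧ G.edgeSet.ncard = e}


lemma aux_path_of_snd {V : Type*} {H : SimpleGraph V} {u v : V} (c : H.Walk u u)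
    (hc : c.IsCycle) (hs : c.snd = v) :
    ∃ p : H.Walk v u, p.IsPath ∧ s(u, v) ∉ p.edges ∧ p.length + 1 = c.length := by
  cases c with
  | nil => simp at hc
  | cons h p =>
    simp only [Walk.snd_cons] at hs
    subst hs
    rw [Walk.cons_isCycle_iff] at hc
    exact ⟨p, hc.1, hc.2, by simp⟩

lemma aux_path_of_mem {V : Type*} {H : SimpleGraph V} {u v : V} {a : V} (c : H.Walk a a)
    (hc : c.IsCycle) (hs : s(u, v) ∈ c.edges) :
    ∃ p : H.Walk v u, p.IsPath ∧ s(u, v) ∉ p.edges ∧ p.length + 1 = c.length := by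
  classical
  have hu := c.fst_mem_support_of_mem_edges hs
  set d := c.rotate u hu with hd
  have hdc : d.IsCycle := hc.rotate hu
  have hde : s(u, v) ∈ d.edges := (c.rotate_edges u hu).mem_iff.mpr hs
  have hl : d.length = c.length := by simp [hd]
  rw [← hl]
  clear_value d
  by_cases h1 : d.snd = v
  · exact aux_path_of_snd d hdc h1
  · have h2 : d.reverse.snd = v := by
      cases d with
      | nil => simp at hdc
      | cons h p =>
        have hp := (Walk.cons_isCycle_iff _ _).mp hdc
        simp only [Walk.snd_cons] at h1
        rw [Walk.edges_cons, List.mem_cons] at hde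
        rcases hde with he | he
        · simp only [Sym2.eq_iff] at he
          grind
        · have := hp.1.eq_penultimate_of_mem_edges he
          have hn : ¬ p.Nil := by
            intro hn
            rw [Walk.edges_eq_nil.mpr hn] at he
            simp at he
          rw [Walk.snd_reverse, Walk.penultimate_cons_of_not_nil _ _ hn, this]
    simpa using aux_path_of_snd d.reverse hdc.reverse h2

lemma aux_cycle {V : Type*} {G : SimpleGraph V} {x y : V} (p : G.Walk x y) (hp : p.IsPath)
    (hl : 2 ≤ p.length) (h : G.Adj y x) : HasCycleLength G (p.length + 1) := by
  refine ⟨y, Walk.cons h p, ?_, by simp⟩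
  rw [Walk.cons_isCycle_iff]
  refine ⟨hp, fun he => ?_⟩
  rw [Sym2.eq_swap] at he
  have := hp.length_eq_one_of_mem_edges he
  omega

lemma aux_girth {V : Type*} {G : SimpleGraph V} (c : G.Coloring Bool) {ℓ : ℕ}
    (hG : EvenCycleFree G ℓ) {x y : V} (p : G.Walk x y) (hp : p.IsPath)
    (hl : 2 ≤ p.length) (hl2 : p.length < 2 * ℓ) (h : G.Adj y x) : False := by
  have h1 : Even (Walk.cons h p).length := by
    rw [c.even_length_iff_congr]
  rw [Walk.length_cons] at h1
  obtain ⟨m, hm⟩ := h1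
  have h2 := aux_cycle p hp hl h
  rw [hm, ← two_mul] at h2
  exact hG m (by omega) (by omega) h2

lemma aux_no_path {V : Type*} {G : SimpleGraph V} (c : G.Coloring Bool) {ℓ : ℕ}
    (hG : EvenCycleFree G ℓ) {u v w : V} (huw : G.Adj u w) (hwv : G.Adj w v)
    (p : G.Walk v u) (hp : p.IsPath) (h4 : 4 ≤ p.length) (hlt : p.length + 1 < 2 * ℓ) :
    False := by
  classical
  by_cases hw : w ∈ p.support
  · have hsum : (p.takeUntil w hw).length + (p.dropUntil w hw).length = p.length := by
      rw [← Walk.length_append, Walk.take_spec]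
    by_cases h : 2 ≤ (p.takeUntil w hw).length
    · exact aux_girth c hG _ (hp.takeUntil hw) h (by omega) hwv
    · exact aux_girth c hG _ (hp.dropUntil hw) (by omega) (by omega) huw
  · exact aux_girth c hG (Walk.cons hwv p) (hp.cons hw) (by simp; omega) (by simp; omega) huw

lemma aux_choose {n : ℕ} (hn : 3 ≤ n) {G : SimpleGraph (Fin n)} (c : G.Coloring Bool) {ℓ k : ℕ}
    (hG : EvenCycleFree G ℓ) (hk5 : 5 ≤ k) (hklt : k < 2 * ℓ) :
    ∃ u v, u ≠ v ∧ c u = c v ∧ ∀ p : G.Walk v u, p.IsPath → p.length + 1 ≠ k := by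
  by_cases h : ∃ u v w, u ≠ v ∧ G.Adj u w ∧ G.Adj w v
  · obtain ⟨u, v, w, huv, huw, hwv⟩ := h
    refine ⟨u, v, huv, ?_, fun p hp hl => ?_⟩
    · have h1 := c.valid huw
      have h2 := c.valid hwv
      revert h1 h2
      cases c u <;> cases c v <;> cases c w <;> simp
    · exact aux_no_path c hG huw hwv p hp (by omega) (by omega)
  · obtain ⟨u, v, huv, hcuv⟩ := Fintype.exists_ne_map_eq_of_card_lt c (by simp; omega)
    refine ⟨u, v, huv, hcuv, fun p hp hl => h ?_⟩
    refine ⟨p.getVert 0, p.getVert 2, p.getVert 1, ?_, p.adj_getVert_succ (by omega),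
      p.adj_getVert_succ (by omega)⟩
    intro he
    have := hp.getVert_injOn (by simp : (0:ℕ) ∈ {i | i ≤ p.length})
      (by simp; omega : (2:ℕ) ∈ {i | i ≤ p.length}) he
    omega

lemma aux_bdd {n : ℕ} (P : SimpleGraph (Fin n) → Prop) :
    BddAbove {e | ∃ G : SimpleGraph (Fin n), P G ∧ G.edgeSet.ncard = e} := by
  refine ⟨Nat.card (Sym2 (Fin n)), ?_⟩
  rintro e ⟨G, _, rfl⟩
  exact Set.ncard_le_card _

lemma aux_transfer {V : Type*} {G : SimpleGraph V} {u v a b : V} (p : (G ⊔ edge u v).Walk a b)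
    (hp : s(u, v) ∉ p.edges) : ∀ e ∈ p.edges, e ∈ G.edgeSet := by
  intro e he
  have h := p.edges_subset_edgeSet he
  rw [edgeSet_sup] at h
  rcases h with h | h
  · exact h
  · have := edgeSet_edge_subset h
    rw [Set.mem_singleton_iff] at this
    exact absurd (this ▸ he) hp

theorem short_odd_cycle_discrepancy (ℓ k : ℕ) (hℓ : 3 ≤ ℓ) (hk : Odd k)
    (hk5 : 5 ≤ k) (hklt : k < 2 * ℓ) (n : ℕ) (hn : 3 ≤ n) :
    zZar n ℓ + 1 ≤ exTuran n ℓ k := by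
  have hmem : zZar n ℓ ∈ {e | ∃ G : SimpleGraph (Fin n),
      EvenCycleFree G ℓ ∧ G.Colorable 2 ∧ G.edgeSet.ncard = e} := by
    apply Nat.sSup_mem
    · refine ⟨_, ⊥, ?_, ?_, rfl⟩
      · rintro m hm - ⟨v, w, hw, hl⟩
        cases w with
        | nil => simp at hw
        | cons h p => simp at h
      · exact ⟨Coloring.mk (fun _ => 0) (fun {v w} h => by simp at h)⟩
    · simpa only [and_assoc] using aux_bdd fun G : SimpleGraph (Fin n) => EvenCycleFree G ℓ ∧ G.Colorable 2
  obtain ⟨G, hG, hcol, hcard⟩ := hmem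
  rw [← hcard]
  have c : G.Coloring Bool := hcol.toColoring (by simp)
  obtain ⟨u, v, huv, hcuv, hpath⟩ := aux_choose hn c hG hk5 hklt
  have hnadj : ¬ G.Adj u v := fun h => c.valid h hcuv
  apply le_csSup
  · simpa only [and_assoc] using
      aux_bdd fun G : SimpleGraph (Fin n) => EvenCycleFree G ℓ ∧ ¬ HasCycleLength G k
  have key : ∀ m, HasCycleLength (G ⊔ edge u v) m → HasCycleLength G m ∨
      ∃ p : G.Walk v u, p.IsPath ∧ p.length + 1 = m := by
    rintro m ⟨a, w, hw, rfl⟩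
    by_cases he : s(u, v) ∈ w.edges
    · right
      obtain ⟨p, hp, hpe, hl⟩ := aux_path_of_mem w hw he
      exact ⟨p.transfer G (aux_transfer p hpe), hp.transfer _, by simpa using hl⟩
    · left
      exact ⟨a, w.transfer G (aux_transfer w he), hw.transfer _, by simp⟩
  refine ⟨G ⊔ edge u v, ?_, ?_, ?_⟩
  · intro m h2 hm h
    rcases key _ h with h | ⟨p, hp, hl⟩
    · exact hG m h2 hm h
    · have : Even p.length := by rw [c.even_length_iff_congr, hcuv]
      obtain ⟨r, hr⟩ := this
      omega
  · intro h
    rcases key _ h with ⟨a, w, hw, hl⟩ | ⟨p, hp, hl⟩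
    · have : Even w.length := by rw [c.even_length_iff_congr]
      rw [hl] at this
      exact Nat.not_even_iff_odd.mpr hk this
    · exact hpath p hp hl
  · rw [edgeSet_sup, edgeSet_edge_of_ne huv, Set.union_singleton,
      Set.ncard_insert_of_notMem (by simpa using hnadj)]
end

section
/- (Blakley–Roy inequality.) Let G be a graph on n ≥ 1 vertices with e(G) edges and let k ≥ 1 be an integer. Then the number W_k of walks of length k in G satisfies n^{k−1} · W_k ≥ (2·e(G))^k; equivalently, W_k ≥ n·d^k where d = 2e(G)/n is the average degree. -/
open SimpleGraph

/-- The number of walks of length `k` in `G`, counted as ordered sequences of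
`k + 1` vertices in which consecutive vertices are adjacent. -/
noncomputable def walkCount {V : Type*} [Fintype V] (G : SimpleGraph V) (k : ℕ) : ℕ :=
  Set.ncard {f : Fin (k + 1) → V | ∀ i : Fin k, G.Adj (f i.castSucc) (f i.succ)}

/-- number of walks of length `k` from `v` -/
noncomputable def wcnt {V : Type*} [Fintype V] (A : V → V → Prop) [DecidableRel A] : ℕ → V → ℕ
  | 0, _ => 1
  | (k + 1), v => ∑ u, if A v u then wcnt A k u else 0

theorem wcnt_eq {V : Type*} [Fintype V] (A : V → V → Prop) [DecidableRel A] (k : ℕ) (v : V) :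
    (∑ g : Fin k → V, if (∀ i : Fin k, A ((Fin.cons v g : Fin (k+1) → V) i.castSucc)
      ((Fin.cons v g : Fin (k+1) → V) i.succ)) then 1 else 0) = wcnt A k v := by
  induction k generalizing v with
  | zero => simp [wcnt]
  | succ k ih =>
    rw [← (Fin.consEquiv (fun _ : Fin (k+1) => V)).sum_comp, Fintype.sum_prod_type, wcnt]
    refine Finset.sum_congr rfl fun u _ => ?_
    rw [← ih u]
    split_ifs with h
    · refine Finset.sum_congr rfl fun g _ => ?_
      simp only [Fin.forall_fin_succ, Fin.consEquiv_apply, Fin.castSucc_zero, Fin.cons_zero,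
        Fin.cons_succ, h, true_and, ← Fin.succ_castSucc]
    · refine Finset.sum_eq_zero fun g _ => ?_
      rw [if_neg]
      intro h'
      exact h (by simpa using h' 0)

theorem walkCount_eq {V : Type*} [Fintype V] (G : SimpleGraph V) [DecidableRel G.Adj] (k : ℕ) :
    walkCount G k = ∑ v, wcnt G.Adj k v := by
  classical
  unfold walkCount
  rw [Set.ncard_eq_toFinset_card', Set.toFinset_ofPred, Finset.card_filter,
    ← (Fin.consEquiv (fun _ : Fin (k+1) => V)).sum_comp, Fintype.sum_prod_type]
  refine Finset.sum_congr rfl fun u _ => ?_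
  rw [← wcnt_eq]
  rfl

/-- weighted Jensen for the logarithm -/
theorem jensen_log {V : Type*} (s : Finset V) (a x : V → ℝ) (ha : ∀ i ∈ s, 0 < a i)
    (hx : ∀ i ∈ s, 0 < x i) (hs : s.Nonempty) :
    ∑ i ∈ s, a i * Real.log (x i) ≤
      (∑ i ∈ s, a i) * (Real.log (∑ i ∈ s, a i * x i) - Real.log (∑ i ∈ s, a i)) := by
  have hA : 0 < ∑ i ∈ s, a i := Finset.sum_pos ha hs
  have hX : 0 < ∑ i ∈ s, a i * x i := Finset.sum_pos (fun i hi => mul_pos (ha i hi) (hx i hi)) hs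
  set A := ∑ i ∈ s, a i with hAd
  set X := ∑ i ∈ s, a i * x i with hXd
  have h : ∀ i ∈ s, a i * Real.log (x i) ≤
      a i * (Real.log X - Real.log A) + (a i * x i * (A / X) - a i) := by
    intro i hi
    have h1 := Real.log_le_sub_one_of_pos (show 0 < x i * (A / X) from
      mul_pos (hx i hi) (div_pos hA hX))
    rw [Real.log_mul (hx i hi).ne' (div_pos hA hX).ne', Real.log_div hA.ne' hX.ne'] at h1
    nlinarith [ha i hi]
  refine (Finset.sum_le_sum h).trans (le_of_eq ?_)
  rw [Finset.sum_add_distrib, Finset.sum_sub_distrib, ← Finset.sum_mul, ← Finset.sum_mul,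
    ← hAd, ← hXd]
  field_simp
  ring

theorem wcnt_pos {V : Type*} [Fintype V] (G : SimpleGraph V) [DecidableRel G.Adj] (k : ℕ) (v : V)
    (hv : ∃ u, G.Adj v u) : 0 < wcnt G.Adj k v := by
  induction k generalizing v with
  | zero => simp [wcnt]
  | succ k ih =>
    obtain ⟨u, hu⟩ := hv
    rw [wcnt]
    refine Finset.sum_pos' (fun _ _ => Nat.zero_le _) ⟨u, Finset.mem_univ _, ?_⟩
    rw [if_pos hu]
    exact ih u ⟨v, hu.symm⟩

theorem swap_sum {V : Type*} [Fintype V] (G : SimpleGraph V) [DecidableRel G.Adj] (f : V → ℝ) :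
    ∑ v, ∑ u ∈ G.neighborFinset v, f u = ∑ u, (G.degree u : ℝ) * f u := by
  classical
  have : ∀ v, ∑ u ∈ G.neighborFinset v, f u = ∑ u, if G.Adj v u then f u else 0 := by
    intro v
    rw [← Finset.sum_filter, G.neighborFinset_eq_filter]
  simp_rw [this]
  rw [Finset.sum_comm]
  refine Finset.sum_congr rfl fun u _ => ?_
  rw [← Finset.sum_filter, Finset.sum_const, nsmul_eq_mul, ← G.card_neighborFinset_eq_degree,
    G.neighborFinset_eq_filter]
  simp_rw [G.adj_comm u]

theorem wcnt_succ {V : Type*} [Fintype V] (G : SimpleGraph V) [DecidableRel G.Adj] (k : ℕ)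
    (v : V) : (wcnt G.Adj (k+1) v : ℝ) = ∑ u ∈ G.neighborFinset v, (wcnt G.Adj k u : ℝ) := by
  classical
  rw [wcnt, ← Finset.sum_filter, G.neighborFinset_eq_filter]
  push_cast
  rfl

theorem log_bound {V : Type*} [Fintype V] (G : SimpleGraph V) [DecidableRel G.Adj] (k : ℕ) :
    (k : ℝ) * ∑ v, (G.degree v : ℝ) * Real.log (G.degree v) ≤
      ∑ v, (G.degree v : ℝ) * Real.log (wcnt G.Adj k v) := by
  induction k with
  | zero => simp [wcnt]
  | succ k ih =>
    have h : ∀ v, (G.degree v : ℝ) * Real.log (G.degree v) +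
        ∑ u ∈ G.neighborFinset v, Real.log (wcnt G.Adj k u) ≤
        (G.degree v : ℝ) * Real.log (wcnt G.Adj (k+1) v) := by
      intro v
      by_cases hv : (G.neighborFinset v).Nonempty
      · have := jensen_log (G.neighborFinset v) (fun _ => 1) (fun u => (wcnt G.Adj k u : ℝ))
          (fun _ _ => one_pos) (fun u hu => by
            have := wcnt_pos G k u ⟨v, ((G.mem_neighborFinset v u).1 hu).symm⟩
            exact_mod_cast this) hv
        simp only [one_mul, Finset.sum_const, nsmul_eq_mul, mul_one,
          G.card_neighborFinset_eq_degree, ← wcnt_succ] at this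
        linarith
      · rw [Finset.not_nonempty_iff_eq_empty] at hv
        have hd : G.degree v = 0 := by rw [← G.card_neighborFinset_eq_degree, hv]; rfl
        simp [hv, hd]
    have h2 := Finset.sum_le_sum fun v (_ : v ∈ Finset.univ) => h v
    rw [Finset.sum_add_distrib, swap_sum] at h2
    push_cast
    linarith

/-- Blakley–Roy inequality: `W_k ≥ n·d^k` where `d = 2e(G)/n`, stated as
`n^{k-1} · W_k ≥ (2·e(G))^k`. -/
theorem blakley_roy {V : Type*} [Fintype V] (G : SimpleGraph V)
    (hn : 1 ≤ Fintype.card V) (k : ℕ) (hk : 1 ≤ k) :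
    (2 * G.edgeSet.ncard) ^ k ≤ (Fintype.card V) ^ (k - 1) * walkCount G k := by
  classical
  obtain ⟨k, rfl⟩ : ∃ j, k = j + 1 := ⟨k - 1, by omega⟩
  have hE : 2 * G.edgeSet.ncard = ∑ v, G.degree v := by
    rw [G.sum_degrees_eq_twice_card_edges, Set.ncard_eq_toFinset_card', SimpleGraph.edgeFinset]
  rw [hE, walkCount_eq, Nat.add_sub_cancel]
  set D := ∑ v, G.degree v with hD
  rcases Nat.eq_zero_or_pos D with h0 | hpos
  · rw [h0]; simp
  set s : Finset V := Finset.univ.filter fun v => G.degree v ≠ 0 with hsdef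
  have hsum : ∀ f : V → ℝ, ∑ v ∈ s, (G.degree v : ℝ) * f v = ∑ v, (G.degree v : ℝ) * f v := by
    intro f
    refine Finset.sum_subset (Finset.subset_univ _) fun v _ hv => ?_
    have : G.degree v = 0 := by simpa [hsdef] using hv
    simp [this]
  have hdpos : ∀ v ∈ s, (0 : ℝ) < G.degree v := by
    intro v hv
    have : G.degree v ≠ 0 := by simpa [hsdef] using hv
    exact_mod_cast Nat.pos_of_ne_zero this
  have hsD : ∑ v ∈ s, (G.degree v : ℝ) = D := by
    have := hsum fun _ => 1
    simp only [mul_one] at this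
    rw [this, hD]; push_cast; rfl
  have hDR : (0 : ℝ) < D := by exact_mod_cast hpos
  have hs : s.Nonempty := by
    by_contra h
    rw [Finset.not_nonempty_iff_eq_empty] at h
    rw [h, Finset.sum_empty] at hsD
    exact hDR.ne hsD
  have hW : ((∑ v, wcnt G.Adj (k+1) v : ℕ) : ℝ) = ∑ v, (G.degree v : ℝ) * wcnt G.Adj k v := by
    rw [← swap_sum]
    push_cast
    exact Finset.sum_congr rfl fun v _ => wcnt_succ G k v
  have hwpos : ∀ v ∈ s, (0 : ℝ) < wcnt G.Adj k v := by
    intro v hv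
    have h1 : 0 < G.degree v := by exact_mod_cast hdpos v hv
    have := wcnt_pos G k v ((G.degree_pos_iff_exists_adj v).1 h1)
    exact_mod_cast this
  have j1 := jensen_log s (fun v => (G.degree v : ℝ)) (fun v => (wcnt G.Adj k v : ℝ)) hdpos hwpos hs
  have j2 := jensen_log s (fun v => (G.degree v : ℝ)) (fun v => ((G.degree v : ℝ))⁻¹) hdpos
    (fun v hv => inv_pos.2 (hdpos v hv)) hs
  have hWpos : (0 : ℝ) < ((∑ v, wcnt G.Adj (k+1) v : ℕ) : ℝ) := by
    rw [hW, ← hsum]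
    exact Finset.sum_pos (fun v hv => mul_pos (hdpos v hv) (hwpos v hv)) hs
  rw [hsum, hsum, hsD, ← hW] at j1
  have hc : ∑ v ∈ s, (G.degree v : ℝ) * ((G.degree v : ℝ))⁻¹ = s.card := by
    rw [Finset.sum_congr rfl fun v hv => mul_inv_cancel₀ (hdpos v hv).ne']
    simp
  rw [hc, hsD] at j2
  simp only [Real.log_inv, mul_neg, Finset.sum_neg_distrib] at j2
  rw [hsum] at j2
  have hlog : Real.log s.card ≤ Real.log (Fintype.card V) := by
    apply Real.log_le_log
    · exact_mod_cast hs.card_pos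
    · exact_mod_cast Finset.card_le_univ s
  have lb := log_bound G k
  set L := ∑ v, (G.degree v : ℝ) * Real.log (G.degree v)
  set W := ∑ v, wcnt G.Adj (k+1) v
  have hL : (D : ℝ) * (Real.log D - Real.log (Fintype.card V)) ≤ L := by
    have := mul_le_mul_of_nonneg_left hlog hDR.le
    linarith
  have hkL := mul_le_mul_of_nonneg_left hL (Nat.cast_nonneg (α := ℝ) k)
  have key : (D : ℝ) * (k * (Real.log D - Real.log (Fintype.card V))) ≤
      D * (Real.log W - Real.log D) := by linarith
  have key2 := le_of_mul_le_mul_left key hDR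
  have hnR : (0 : ℝ) < Fintype.card V := by exact_mod_cast hn
  have fin : ((D : ℝ)) ^ (k+1) ≤ (Fintype.card V : ℝ) ^ k * W := by
    rw [← Real.log_le_log_iff (by positivity) (by positivity),
      Real.log_mul (by positivity) (by positivity), Real.log_pow, Real.log_pow]
    push_cast
    linarith
  exact_mod_cast fin
end

section
/- Let G be a graph on n ≥ 1 vertices and let r, s be integers with r even and r ≥ s ≥ 1. Let W_j denote the number of walks of length j in G. Then (W_r)^s · n^{r−s} ≥ (W_s)^r; equivalently, w_r^{1/r} ≥ w_s^{1/s}, where w_j = W_j/n. -/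
open SimpleGraph

lemma wpm_sum {V : Type*} [Fintype V] [DecidableEq V] (A : Matrix V V ℝ) (k : ℕ) :
    ∀ h : V → ℝ, ∑ f : Fin (k + 1) → V, h (f 0) * ∏ i : Fin k, A (f i.castSucc) (f i.succ)
      = h ⬝ᵥ ((A ^ k).mulVec 1) := by
  induction k with
  | zero =>
    intro h
    rw [← (Equiv.funUnique (Fin 1) V).symm.sum_comp]
    simp [dotProduct]
  | succ k ih =>
    intro h
    rw [pow_succ', ← Matrix.mulVec_mulVec, Matrix.dotProduct_mulVec, ← ih,
      ← (Fin.consEquiv (fun _ : Fin (k + 2) => V)).sum_comp, Fintype.sum_prod_type,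
      Finset.sum_comm]
    refine Finset.sum_congr rfl fun f _ => ?_
    simp only [Matrix.vecMul, dotProduct, Finset.sum_mul]
    refine Finset.sum_congr rfl fun v _ => ?_
    rw [Fin.prod_univ_succ]
    simp only [Fin.consEquiv_apply, Fin.cons_zero, Fin.cons_succ, Fin.castSucc_zero,
      ← Fin.succ_castSucc]
    ring

lemma wpm_count {V : Type*} [Fintype V] [DecidableEq V] (G : SimpleGraph V)
    [DecidableRel G.Adj] (k : ℕ) :
    (walkCount G k : ℝ) = (1 : V → ℝ) ⬝ᵥ ((G.adjMatrix ℝ ^ k).mulVec 1) := by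
  rw [← wpm_sum, walkCount, Set.ncard_eq_toFinset_card']
  simp only [Pi.one_apply, one_mul, SimpleGraph.adjMatrix_apply, Finset.prod_ite_zero,
    Finset.prod_const_one, Finset.sum_boole, Finset.mem_univ, forall_const]
  congr 2
  ext f
  simp

lemma wpm_eig {V : Type*} [Fintype V] [DecidableEq V] (A : Matrix V V ℝ) (hA : A.IsHermitian)
    (u : V → ℝ) (k : ℕ) :
    u ⬝ᵥ ((A ^ k).mulVec u) =
      ∑ i, (u ⬝ᵥ (hA.eigenvectorBasis i).ofLp) ^ 2 * hA.eigenvalues i ^ k := by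
  have hp : ∀ i, (A ^ k).mulVec (hA.eigenvectorBasis i).ofLp
      = hA.eigenvalues i ^ k • (hA.eigenvectorBasis i).ofLp := by
    intro i
    induction k with
    | zero => simp
    | succ k ih =>
      rw [pow_succ, ← Matrix.mulVec_mulVec, hA.mulVec_eigenvectorBasis, Matrix.mulVec_smul, ih,
        smul_smul, pow_succ']
  have hT : (A ^ k).transpose = A ^ k := by
    have : A.transpose = A := by simpa [Matrix.IsHermitian] using hA
    rw [Matrix.transpose_pow, this]
  have h := hA.eigenvectorBasis.sum_inner_mul_inner (WithLp.toLp 2 u)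
    (WithLp.toLp 2 ((A ^ k).mulVec u))
  simp only [EuclideanSpace.inner_eq_star_dotProduct, star_trivial] at h
  rw [dotProduct_comm, ← h]
  refine Finset.sum_congr rfl fun i _ => ?_
  have h2 : (A ^ k).mulVec u ⬝ᵥ (hA.eigenvectorBasis i).ofLp =
      hA.eigenvalues i ^ k * (u ⬝ᵥ (hA.eigenvectorBasis i).ofLp) := by
    rw [← hT, Matrix.mulVec_transpose, ← Matrix.dotProduct_mulVec, hp, dotProduct_smul,
      smul_eq_mul]
  rw [h2, dotProduct_comm _ u]
  ring

/-- Godsil's inequality: for `r` even with `r ≥ s ≥ 1`, `w_r^{1/r} ≥ w_s^{1/s}`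
where `w_j = W_j/n`, stated as `(W_r)^s · n^{r-s} ≥ (W_s)^r`. -/
theorem walk_power_mean {V : Type*} [Fintype V] (G : SimpleGraph V)
    (hn : 1 ≤ Fintype.card V) (r s : ℕ) (hr : Even r) (hs : 1 ≤ s) (hrs : s ≤ r) :
    (walkCount G s) ^ r ≤ (walkCount G r) ^ s * (Fintype.card V) ^ (r - s) := by
  classical
  have hA : (G.adjMatrix ℝ).IsHermitian := by
    simp [Matrix.IsHermitian]
  have key : ∀ k, (walkCount G k : ℝ) = _ := fun k =>
    (wpm_count G k).trans (wpm_eig _ hA 1 k)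
  set c : V → ℝ := fun i => ((1 : V → ℝ) ⬝ᵥ (hA.eigenvectorBasis i).ofLp) ^ 2 with hc
  set l := hA.eigenvalues
  have hc0 : ∀ i, 0 ≤ c i := fun i => sq_nonneg _
  have hsum : ∑ i, c i = (Fintype.card V : ℝ) := by
    have h0 := wpm_eig _ hA (1 : V → ℝ) 0
    simpa [hc, dotProduct] using h0.symm
  set n : ℝ := (Fintype.card V : ℝ) with hnn
  have hn0 : 0 < n := by rw [hnn]; exact_mod_cast hn
  have hs0 : (0 : ℝ) < s := by exact_mod_cast hs
  have hp1 : (1 : ℝ) ≤ (r : ℝ) / s := by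
    rw [le_div_iff₀ hs0]; simpa using (by exact_mod_cast hrs : (s : ℝ) ≤ r)
  have pm := Real.rpow_arith_mean_le_arith_mean_rpow Finset.univ (fun i => c i / n)
    (fun i => |l i| ^ s) (fun i _ => div_nonneg (hc0 i) hn0.le)
    (by rw [← Finset.sum_div, hsum, div_self hn0.ne']) (fun i _ => by positivity) hp1
  have e1 : ∀ x : ℝ, 0 ≤ x → (x ^ s) ^ ((r : ℝ) / s) = x ^ r := by
    intro x hx
    rw [← Real.rpow_natCast, ← Real.rpow_mul hx, mul_div_cancel₀ _ hs0.ne', Real.rpow_natCast]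
  have e2 : ∀ x : ℝ, 0 ≤ x → (x ^ ((r : ℝ) / s)) ^ s = x ^ r := by
    intro x hx
    rw [← Real.rpow_natCast, ← Real.rpow_mul hx, div_mul_cancel₀ _ hs0.ne', Real.rpow_natCast]
  have hR : ∑ i, c i / n * (|l i| ^ s) ^ ((r : ℝ) / s) = walkCount G r / n := by
    rw [key, Finset.sum_div]
    refine Finset.sum_congr rfl fun i _ => ?_
    rw [e1 _ (abs_nonneg _), hr.pow_abs]
    ring
  have hL : (walkCount G s : ℝ) / n ≤ ∑ i, c i / n * |l i| ^ s := by
    rw [key, Finset.sum_div]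
    refine Finset.sum_le_sum fun i _ => ?_
    have : l i ^ s ≤ |l i| ^ s := by rw [← abs_pow]; exact le_abs_self _
    calc c i * l i ^ s / n = c i / n * l i ^ s := by ring
      _ ≤ _ := mul_le_mul_of_nonneg_left this (div_nonneg (hc0 i) hn0.le)
  rw [hR] at pm
  have hM0 : (0 : ℝ) ≤ ∑ i, c i / n * |l i| ^ s := le_trans (by positivity) hL
  have h3 : ((walkCount G s : ℝ) / n) ^ r ≤ ((walkCount G r : ℝ) / n) ^ s := by
    calc _ ≤ (∑ i, c i / n * |l i| ^ s) ^ r := pow_le_pow_left₀ (by positivity) hL _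
      _ = ((∑ i, c i / n * |l i| ^ s) ^ ((r : ℝ) / s)) ^ s := (e2 _ hM0).symm
      _ ≤ _ := pow_le_pow_left₀ (Real.rpow_nonneg hM0 _) pm _
  have h4 : (walkCount G s : ℝ) ^ r ≤ (walkCount G r : ℝ) ^ s * n ^ (r - s) := by
    rw [div_pow, div_pow, div_le_iff₀ (by positivity)] at h3
    refine h3.trans_eq ?_
    have : n ^ r = n ^ s * n ^ (r - s) := by rw [← pow_add, Nat.add_sub_cancel' hrs]
    rw [this]
    field_simp
  rw [hnn] at h4
  exact_mod_cast h4
end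

section
/- Let ℓ ≥ 1 be an integer and let G be a bipartite graph with parts A and B, maximum degree at most Δ, containing no cycle of length at most 2ℓ + 1. Then for every vertex v of G, the number of closed walks of length 2ℓ + 2 that start and end at v is at most Δ² · max(|A|, |B|) + (4Δ)^{ℓ+1}. -/
open SimpleGraph

/-- The number of closed walks of length `k` in `G` starting and ending at `v`,
counted as ordered sequences of `k + 1` vertices. -/
noncomputable def closedWalkCountFrom {V : Type*} [Fintype V] (G : SimpleGraph V)
    (v : V) (k : ℕ) : ℕ :=
  Set.ncard {f : Fin (k + 1) → V | f 0 = v ∧ f (Fin.last k) = v ∧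
    ∀ i : Fin k, G.Adj (f i.castSucc) (f i.succ)}

theorem cw_path_unique {V : Type*} (G : SimpleGraph V) (N : ℕ)
    (hg : ∀ m, m ≤ N → ¬ HasCycleLength G m) {u v : V} (p q : G.Walk u v)
    (hp : p.IsPath) (hq : q.IsPath) (hl : p.length + q.length ≤ N) : p = q := by
  classical
  let S : Set (Sym2 V) := {e | e ∈ p.edges ∨ e ∈ q.edges}
  have hSG : ∀ e ∈ S, e ∈ G.edgeSet := by
    rintro e (he | he)
    · exact p.edges_subset_edgeSet he
    · exact q.edges_subset_edgeSet he
  let H := SimpleGraph.fromEdgeSet S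
  have hH : ∀ e ∈ S, e ∈ H.edgeSet := by
    intro e he
    rw [SimpleGraph.edgeSet_fromEdgeSet]
    exact ⟨he, G.not_isDiag_of_mem_edgeSet (hSG e he)⟩
  have hHS : H.edgeSet ⊆ S := by
    rw [SimpleGraph.edgeSet_fromEdgeSet]; exact Set.sdiff_subset
  have hHG : H ≤ G := by
    rw [← SimpleGraph.edgeSet_subset_edgeSet]
    exact fun e he => hSG e (hHS he)
  have hac : H.IsAcyclic := by
    intro x c hc
    refine hg c.length ?_ ⟨x, c.mapLe hHG, hc.mapLe hHG, by simp⟩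
    have h1 : c.edges.toFinset ⊆ p.edges.toFinset ∪ q.edges.toFinset := by
      intro e he
      have := hHS (c.edges_subset_edgeSet (by simpa using he))
      simpa [S] using this
    have h2 := Finset.card_le_card h1
    rw [List.toFinset_card_of_nodup hc.edges_nodup, Walk.length_edges] at h2
    have h3 := Finset.card_union_le p.edges.toFinset q.edges.toFinset
    have h4 := p.edges.toFinset_card_le
    have h5 := q.edges.toFinset_card_le
    rw [Walk.length_edges] at h4 h5
    omega
  have hpH : ∀ e ∈ p.edges, e ∈ H.edgeSet := fun e he => hH e (Or.inl he)
  have hqH : ∀ e ∈ q.edges, e ∈ H.edgeSet := fun e he => hH e (Or.inr he)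
  have := (hac.subsingleton_path u v).elim ⟨p.transfer H hpH, hp.transfer hpH⟩ ⟨q.transfer H hqH, hq.transfer hqH⟩
  have h := congrArg (fun w : H.Path u v => w.1.support) this
  simp only [Walk.support_transfer] at h
  exact Walk.ext_support h

theorem cw_down_unique {V : Type*} (G : SimpleGraph V) (ℓ : ℕ)
    (hg : ∀ m, m ≤ 2 * ℓ + 1 → ¬ HasCycleLength G m) {v u w₁ w₂ : V}
    (hr : G.Reachable v u) (hd : G.dist v u ≤ ℓ) (h₁ : G.Adj u w₁) (h₂ : G.Adj u w₂)
    (e₁ : G.dist v w₁ + 1 = G.dist v u) (e₂ : G.dist v w₂ + 1 = G.dist v u) : w₁ = w₂ := by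
  obtain ⟨p, hp⟩ := (hr.trans h₁.reachable).symm.exists_walk_length_eq_dist
  obtain ⟨q, hq⟩ := (hr.trans h₂.reachable).symm.exists_walk_length_eq_dist
  rw [SimpleGraph.dist_comm] at hp hq
  have hpl : (Walk.cons h₁ p).length = G.dist u v := by
    rw [Walk.length_cons, SimpleGraph.dist_comm]; omega
  have hql : (Walk.cons h₂ q).length = G.dist u v := by
    rw [Walk.length_cons, SimpleGraph.dist_comm]; omega
  have := cw_path_unique G (2 * ℓ + 1) hg _ _ (Walk.isPath_of_length_eq_dist _ hpl)
    (Walk.isPath_of_length_eq_dist _ hql) (by rw [hpl, hql, SimpleGraph.dist_comm]; omega)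
  have := congrArg Walk.snd this
  simpa using this

theorem cw_dist_step {V : Type*} (G : SimpleGraph V) {v u w : V}
    (hr : G.Reachable v u) (h : G.Adj u w) : G.dist v w ≤ G.dist v u + 1 := by
  obtain ⟨p, hp⟩ := hr.exists_walk_length_eq_dist
  rw [← hp, ← Walk.length_concat p h]
  exact dist_le _

theorem cw_parity {V : Type*} (G : SimpleGraph V) (A B : Set V) (hAB : Disjoint A B)
    (hbip : ∀ u v, G.Adj u v → (u ∈ A ∧ v ∈ B) ∨ (u ∈ B ∧ v ∈ A))
    {v u : V} (p : G.Walk v u) : Even p.length ↔ (v ∈ A ↔ u ∈ A) := by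
  induction p with
  | nil => simp
  | @cons a b c h p ih =>
    rw [Walk.length_cons, Nat.even_add_one, ih]
    have hd := Set.disjoint_left.1 hAB
    rcases hbip _ _ h with ⟨h1, h2⟩ | ⟨h1, h2⟩
    · have : b ∉ A := fun h => hd h h2
      tauto
    · have : a ∉ A := fun h => hd h h1
      tauto

theorem cw_parity' {V : Type*} (G : SimpleGraph V) (A B : Set V) (hAB : Disjoint A B)
    (hbip : ∀ u v, G.Adj u v → (u ∈ A ∧ v ∈ B) ∨ (u ∈ B ∧ v ∈ A))
    {v u : V} (hr : G.Reachable v u) : Even (G.dist v u) ↔ (v ∈ A ↔ u ∈ A) := by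
  obtain ⟨p, hp⟩ := hr.exists_walk_length_eq_dist
  rw [← hp]; exact cw_parity G A B hAB hbip p

theorem cw_dist_adj {V : Type*} (G : SimpleGraph V) (A B : Set V) (hAB : Disjoint A B)
    (hbip : ∀ u v, G.Adj u v → (u ∈ A ∧ v ∈ B) ∨ (u ∈ B ∧ v ∈ A))
    {v u w : V} (hr : G.Reachable v u) (h : G.Adj u w) :
    G.dist v w = G.dist v u + 1 ∨ G.dist v w + 1 = G.dist v u := by
  have hr' := hr.trans h.reachable
  have h1 := cw_dist_step G hr h
  have h2 := cw_dist_step G hr' h.symm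
  have hne : G.dist v w ≠ G.dist v u := by
    intro e
    have p1 := cw_parity' G A B hAB hbip hr
    have p2 := cw_parity' G A B hAB hbip hr'
    rw [e, p1] at p2
    have hd := Set.disjoint_left.1 hAB
    rcases hbip _ _ h with ⟨h1, h2⟩ | ⟨h1, h2⟩
    · have : w ∉ A := fun h => hd h h2
      tauto
    · have : u ∉ A := fun h => hd h h1
      tauto
  omega

/-- walks of length `n` from `u` to `v` staying within distance `ℓ` of `v` -/
def cwR {V : Type*} (G : SimpleGraph V) (v : V) (ℓ n : ℕ) (u : V) : Set (Fin (n + 1) → V) :=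
  {f | f 0 = u ∧ f (Fin.last n) = v ∧ (∀ i : Fin n, G.Adj (f i.castSucc) (f i.succ)) ∧
    ∀ i, G.dist v (f i) ≤ ℓ}

theorem cw_seq_dist {V : Type*} (G : SimpleGraph V) (v : V) (k : ℕ) (g : ℕ → V)
    (hadj : ∀ i < k, G.Adj (g i) (g (i + 1))) (hr : G.Reachable v (g 0)) :
    (∀ i ≤ k, G.Reachable v (g i)) ∧
    (∀ j i, i + j ≤ k → G.dist v (g (i + j)) ≤ G.dist v (g i) + j) ∧
    (∀ j i, i + j ≤ k → G.dist v (g i) ≤ G.dist v (g (i + j)) + j) := by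
  have hR : ∀ i ≤ k, G.Reachable v (g i) := by
    intro i
    induction i with
    | zero => intro _; exact hr
    | succ i ih => intro h; exact (ih (by omega)).trans (hadj i (by omega)).reachable
  refine ⟨hR, ?_, ?_⟩
  · intro j
    induction j with
    | zero => intro i _; simp
    | succ j ih =>
      intro i h
      have h1 := ih i (by omega)
      have h2 := cw_dist_step G (hR (i + j) (by omega)) (hadj (i + j) (by omega))
      rw [← add_assoc i j 1]; omega
  · intro j
    induction j with
    | zero => intro i _; simp
    | succ j ih =>
      intro i h
      have h1 := ih i (by omega)
      have h2 := cw_dist_step G (hR (i + j + 1) (by omega)) (hadj (i + j) (by omega)).symm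
      rw [← add_assoc i j 1]; omega

/-- extension of a finite sequence to the natural numbers -/
def cwExt {V : Type*} {k : ℕ} (f : Fin (k + 1) → V) (i : ℕ) : V :=
  f ⟨min i k, by omega⟩

theorem cwExt_apply {V : Type*} {k : ℕ} (f : Fin (k + 1) → V) (i : ℕ) (h : i < k + 1) :
    cwExt f i = f ⟨i, h⟩ := by
  unfold cwExt; congr 2; omega

theorem cwExt_adj {V : Type*} (G : SimpleGraph V) {k : ℕ} (f : Fin (k + 1) → V)
    (h : ∀ i : Fin k, G.Adj (f i.castSucc) (f i.succ)) :
    ∀ i < k, G.Adj (cwExt f i) (cwExt f (i + 1)) := by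
  intro i hi
  rw [cwExt_apply f i (by omega), cwExt_apply f (i + 1) (by omega)]
  exact h ⟨i, hi⟩

theorem cwR_bound {V : Type*} [Fintype V] (G : SimpleGraph V)
    (ℓ Δ : ℕ) (A B : Set V) (hAB : Disjoint A B)
    (hbip : ∀ u v, G.Adj u v → (u ∈ A ∧ v ∈ B) ∨ (u ∈ B ∧ v ∈ A))
    (hΔ : ∀ v : V, (G.neighborSet v).ncard ≤ Δ)
    (hg : ∀ m, m ≤ 2 * ℓ + 1 → ¬ HasCycleLength G m) (v : V) (n : ℕ) :
    ∀ u, G.Reachable v u → G.dist v u ≤ ℓ →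
      (n < G.dist v u → (cwR G v ℓ n u).ncard = 0) ∧
      (cwR G v ℓ n u).ncard ≤ 2 ^ n * Δ ^ ((n - G.dist v u) / 2) := by
  classical
  induction n with
  | zero =>
    intro u hr hd
    constructor
    · intro h
      rw [Set.ncard_eq_zero, Set.eq_empty_iff_forall_notMem]
      rintro f ⟨h0, h1, -⟩
      have : u = v := by rw [← h0, ← h1]; rfl
      subst this
      simp at h
    · simp only [pow_zero, Nat.zero_sub, Nat.zero_div, mul_one]
      rw [Set.ncard_le_one]
      rintro f ⟨h0, -⟩ f' ⟨h0', -⟩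
      funext i
      have hi0 : i = 0 := Fin.ext (by have := i.2; simp)
      rw [hi0, h0, h0']
  | succ n ih =>
    intro u hr hd
    let Nb := G.neighborFinset u
    let U := Nb.filter (fun w => G.dist v w = G.dist v u + 1 ∧ G.dist v w ≤ ℓ)
    let D := Nb.filter (fun w => G.dist v w + 1 = G.dist v u)
    have hsub : cwR G v ℓ (n + 1) u ⊆
        ⋃ w ∈ U ∪ D, (fun f : Fin (n + 1) → V => (Fin.cons u f : Fin (n + 2) → V)) ''
          cwR G v ℓ n w := by
      rintro f ⟨h0, h1, h2, h3⟩
      have ha : G.Adj u (f 1) := by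
        have := h2 0
        rw [Fin.castSucc_zero, h0] at this
        exact this
      simp only [Set.mem_iUnion]
      refine ⟨f 1, ?_, Fin.tail f, ⟨rfl, h1, fun i => h2 i.succ, fun i => h3 i.succ⟩, ?_⟩
      · have hb := h3 1
        rcases cw_dist_adj G A B hAB hbip hr ha with h | h
        · exact Finset.mem_union_left _ (by simp [U, Nb, ha, h]; omega)
        · exact Finset.mem_union_right _ (by simp [D, Nb, ha, h])
      · rw [← h0]; exact Fin.cons_self_tail f
    have hcard : (cwR G v ℓ (n + 1) u).ncard ≤
        ∑ w ∈ U, (cwR G v ℓ n w).ncard + ∑ w ∈ D, (cwR G v ℓ n w).ncard := by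
      refine (Set.ncard_le_ncard hsub (Set.toFinite _)).trans ?_
      refine (Finset.set_ncard_biUnion_le _ _).trans ?_
      rw [← Finset.sum_union_inter]
      refine le_trans ?_ (Nat.le_add_right _ _)
      exact Finset.sum_le_sum fun w _ => Set.ncard_image_le (Set.toFinite _)
    have hU : ∀ w ∈ U, G.Reachable v w ∧ G.dist v w = G.dist v u + 1 ∧ G.dist v w ≤ ℓ := by
      intro w hw
      simp only [U, Nb, Finset.mem_filter, mem_neighborFinset] at hw
      exact ⟨hr.trans hw.1.reachable, hw.2⟩
    have hD : ∀ w ∈ D, G.Adj u w ∧ G.dist v w + 1 = G.dist v u := by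
      intro w hw
      simpa only [D, Nb, Finset.mem_filter, mem_neighborFinset] using hw
    have hUc : U.card ≤ Δ := by
      refine (Finset.card_filter_le _ _).trans ?_
      have := hΔ u
      rwa [Set.ncard_eq_toFinset_card'] at this
    have hDc : D.card ≤ 1 := by
      rw [Finset.card_le_one]
      intro a ha b hb
      exact cw_down_unique G ℓ hg hr hd (hD a ha).1 (hD b hb).1 (hD a ha).2 (hD b hb).2
    have hUz : n < G.dist v u + 1 → ∑ w ∈ U, (cwR G v ℓ n w).ncard = 0 := by
      intro h
      refine Finset.sum_eq_zero fun w hw => ?_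
      obtain ⟨a, b, c⟩ := hU w hw
      exact (ih w a c).1 (by omega)
    have hUs : ∑ w ∈ U, (cwR G v ℓ n w).ncard ≤ 2 ^ n * Δ ^ ((n + 1 - G.dist v u) / 2) := by
      by_cases h : n < G.dist v u + 1
      · rw [hUz h]; exact Nat.zero_le _
      · have : ∑ w ∈ U, (cwR G v ℓ n w).ncard ≤
            U.card • (2 ^ n * Δ ^ ((n - (G.dist v u + 1)) / 2)) := by
          refine Finset.sum_le_card_nsmul _ _ _ fun w hw => ?_
          obtain ⟨a, b, c⟩ := hU w hw
          have := (ih w a c).2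
          rwa [b] at this
        have e : (n + 1 - G.dist v u) / 2 = (n - (G.dist v u + 1)) / 2 + 1 := by omega
        rw [e, pow_succ]
        refine this.trans ?_
        rw [smul_eq_mul]
        calc _ ≤ Δ * (2 ^ n * Δ ^ ((n - (G.dist v u + 1)) / 2)) := Nat.mul_le_mul_right _ hUc
          _ = _ := by ring
    have hDs : ∑ w ∈ D, (cwR G v ℓ n w).ncard ≤ 2 ^ n * Δ ^ ((n + 1 - G.dist v u) / 2) := by
      have : ∑ w ∈ D, (cwR G v ℓ n w).ncard ≤
            D.card • (2 ^ n * Δ ^ ((n + 1 - G.dist v u) / 2)) := by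
        refine Finset.sum_le_card_nsmul _ _ _ fun w hw => ?_
        obtain ⟨a, b⟩ := hD w hw
        have := (ih w (hr.trans a.reachable) (by omega)).2
        rwa [show n - G.dist v w = n + 1 - G.dist v u by omega] at this
      refine this.trans ?_
      rw [smul_eq_mul]
      exact (Nat.mul_le_mul_right _ hDc).trans (by simp)
    constructor
    · intro h
      have hDz : ∑ w ∈ D, (cwR G v ℓ n w).ncard = 0 := by
        refine Finset.sum_eq_zero fun w hw => ?_
        obtain ⟨a, b⟩ := hD w hw
        exact (ih w (hr.trans a.reachable) (by omega)).1 (by omega)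
      have := hUz (by omega)
      omega
    · refine hcard.trans ?_
      rw [pow_succ]
      linarith

theorem cw_peak {V : Type*} [Fintype V] (G : SimpleGraph V)
    (ℓ Δ : ℕ) (A B : Set V) (hAB : Disjoint A B)
    (hcover : A ∪ B = Set.univ)
    (hbip : ∀ u v, G.Adj u v → (u ∈ A ∧ v ∈ B) ∨ (u ∈ B ∧ v ∈ A))
    (hΔ : ∀ v : V, (G.neighborSet v).ncard ≤ Δ)
    (hg : ∀ m, m ≤ 2 * ℓ + 1 → ¬ HasCycleLength G m) (v : V) :
    Set.ncard {f : Fin (2 * ℓ + 2 + 1) → V | (f 0 = v ∧ f (Fin.last (2 * ℓ + 2)) = v ∧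
      ∀ i : Fin (2 * ℓ + 2), G.Adj (f i.castSucc) (f i.succ)) ∧
      G.dist v (cwExt f (ℓ + 1)) = ℓ + 1} ≤ Δ ^ 2 * max A.ncard B.ncard := by
  classical
  set S := {f : Fin (2 * ℓ + 2 + 1) → V | (f 0 = v ∧ f (Fin.last (2 * ℓ + 2)) = v ∧
      ∀ i : Fin (2 * ℓ + 2), G.Adj (f i.castSucc) (f i.succ)) ∧
      G.dist v (cwExt f (ℓ + 1)) = ℓ + 1} with hS
  have key : ∀ f ∈ S, (∀ i < 2 * ℓ + 2, G.Adj (cwExt f i) (cwExt f (i + 1))) ∧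
      (∀ i ≤ 2 * ℓ + 2, G.Reachable v (cwExt f i)) ∧
      (∀ i ≤ ℓ + 1, G.dist v (cwExt f i) = i) ∧
      (∀ j ≤ ℓ + 1, G.dist v (cwExt f (ℓ + 1 + j)) = ℓ + 1 - j) := by
    rintro f ⟨⟨h0, h1, h2⟩, h3⟩
    have hadj := cwExt_adj G f h2
    have e0 : cwExt f 0 = v := h0
    have e1 : cwExt f (2 * ℓ + 2) = v := by
      rw [cwExt_apply f _ (by omega)]; exact h1
    obtain ⟨r, d1, d2⟩ := cw_seq_dist G v _ (cwExt f) hadj (by rw [e0])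
    refine ⟨hadj, r, ?_, ?_⟩
    · intro i hi
      have a := d1 i 0 (by omega)
      have b := d1 (ℓ + 1 - i) i (by omega)
      rw [show i + (ℓ + 1 - i) = ℓ + 1 by omega] at b
      rw [zero_add, e0, SimpleGraph.dist_self] at a
      omega
    · intro j hj
      have a := d2 (ℓ + 1 - j) (ℓ + 1 + j) (by omega)
      have b := d2 j (ℓ + 1) (by omega)
      rw [show ℓ + 1 + j + (ℓ + 1 - j) = 2 * ℓ + 2 by omega, e1, SimpleGraph.dist_self] at a
      omega
  let P : Finset V := Finset.univ.filter (fun u => G.Reachable v u ∧ G.dist v u = ℓ + 1)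
  let T : Finset (Σ _ : V, V × V) :=
    P.sigma (fun u => G.neighborFinset u ×ˢ G.neighborFinset u)
  have hP : P.card ≤ max A.ncard B.ncard := by
    by_cases hall : ∀ u ∈ P, u ∈ A
    · refine le_trans ?_ (le_max_left _ _)
      rw [← Set.ncard_coe_finset]
      exact Set.ncard_le_ncard (fun u hu => hall u hu) (Set.toFinite _)
    · push Not at hall
      obtain ⟨x, hx, hxA⟩ := hall
      refine le_trans ?_ (le_max_right _ _)
      rw [← Set.ncard_coe_finset]
      refine Set.ncard_le_ncard (fun u hu => ?_) (Set.toFinite _)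
      have hu' : u ∈ P := hu
      simp only [P, Finset.mem_filter, Finset.mem_univ, true_and] at hx hu'
      have p1 := cw_parity' G A B hAB hbip hx.1
      have p2 := cw_parity' G A B hAB hbip hu'.1
      rw [hx.2] at p1
      rw [hu'.2, p1] at p2
      have : u ∈ A ∪ B := by rw [hcover]; trivial
      rcases this with h | h
      · tauto
      · exact h
  have hT : T.card ≤ Δ ^ 2 * max A.ncard B.ncard := by
    rw [Finset.card_sigma]
    refine (Finset.sum_le_card_nsmul _ _ (Δ ^ 2) ?_).trans ?_
    · intro u _
      have : (G.neighborFinset u).card ≤ Δ := by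
        have := hΔ u
        rwa [Set.ncard_eq_toFinset_card'] at this
      rw [Finset.card_product, sq]
      exact Nat.mul_le_mul this this
    · rw [smul_eq_mul, mul_comm]
      exact Nat.mul_le_mul_left _ hP
  refine le_trans ?_ hT
  rw [← Set.ncard_coe_finset]
  refine Set.ncard_le_ncard_of_injOn
    (fun f => (⟨cwExt f (ℓ + 1), cwExt f ℓ, cwExt f (ℓ + 2)⟩ : Σ _ : V, V × V)) ?_ ?_
    (Set.toFinite _)
  · intro f hf
    obtain ⟨a, r, d, -⟩ := key f hf
    simp only [T, P, Finset.mem_coe, Finset.mem_sigma, Finset.mem_filter, Finset.mem_univ,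
      true_and, Finset.mem_product, mem_neighborFinset]
    exact ⟨⟨r _ (by omega), d _ le_rfl⟩, (a ℓ (by omega)).symm, a (ℓ + 1) (by omega)⟩
  · intro f hf f' hf' he
    obtain ⟨a, r, d, d2⟩ := key f hf
    obtain ⟨a', r', d', d2'⟩ := key f' hf'
    simp only [Sigma.mk.injEq, heq_eq_eq, Prod.mk.injEq] at he
    obtain ⟨em, el, eu⟩ := he
    have low : ∀ j ≤ ℓ, cwExt f (ℓ - j) = cwExt f' (ℓ - j) := by
      intro j
      induction j with
      | zero => intro _; exact el
      | succ j ih =>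
        intro hj
        have ih := ih (by omega)
        obtain ⟨m, hm⟩ : ∃ m, ℓ - j = m + 1 := ⟨ℓ - j - 1, by omega⟩
        rw [show ℓ - (j + 1) = m by omega]
        rw [hm] at ih
        have A1 := (a m (by omega)).symm
        have A2 := (a' m (by omega)).symm
        rw [← ih] at A2
        have D0 := d (m + 1) (by omega)
        have D1 := d m (by omega)
        have D2 := d' m (by omega)
        exact cw_down_unique G ℓ hg (r (m + 1) (by omega)) (by omega) A1 A2
          (by omega) (by omega)
    have high : ∀ j ≤ ℓ, cwExt f (ℓ + 1 + (j + 1)) = cwExt f' (ℓ + 1 + (j + 1)) := by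
      intro j
      induction j with
      | zero => intro _; exact eu
      | succ j ih =>
        intro hj
        have ih := ih (by omega)
        have A1 := a (ℓ + 1 + (j + 1)) (by omega)
        have A2 := a' (ℓ + 1 + (j + 1)) (by omega)
        rw [← ih] at A2
        have D0 := d2 (j + 1) (by omega)
        have D1 := d2 (j + 1 + 1) (by omega)
        have D2 := d2' (j + 1 + 1) (by omega)
        exact cw_down_unique G ℓ hg (r (ℓ + 1 + (j + 1)) (by omega)) (by omega) A1 A2
          (by omega) (by omega)
    funext i
    rw [← cwExt_apply f i i.2, ← cwExt_apply f' i i.2]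
    have hi := i.2
    rcases lt_trichotomy i.1 (ℓ + 1) with h | h | h
    · have := low (ℓ - i) (by omega)
      rwa [show ℓ - (ℓ - i.1) = i.1 by omega] at this
    · rw [h]; exact em
    · have := high (i - (ℓ + 2)) (by omega)
      rwa [show ℓ + 1 + (i.1 - (ℓ + 2) + 1) = i.1 by omega] at this

/-- In a bipartite graph with parts `A`, `B`, maximum degree at most `Δ`, and no
cycle of length at most `2ℓ + 1`, the number of closed walks of length `2ℓ + 2`
from any vertex `v` is at most `Δ²·max(|A|,|B|) + (4Δ)^{ℓ+1}`. -/
theorem closed_walk_count_bound {V : Type*} [Fintype V] (G : SimpleGraph V)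
    (ℓ Δ : ℕ) (hℓ : 1 ≤ ℓ) (A B : Set V) (hAB : Disjoint A B)
    (hcover : A ∪ B = Set.univ)
    (hbip : ∀ u v, G.Adj u v → (u ∈ A ∧ v ∈ B) ∨ (u ∈ B ∧ v ∈ A))
    (hΔ : ∀ v : V, (G.neighborSet v).ncard ≤ Δ)
    (hgirth : ∀ m, m ≤ 2 * ℓ + 1 → ¬ HasCycleLength G m) (v : V) :
    closedWalkCountFrom G v (2 * ℓ + 2) ≤ Δ ^ 2 * max A.ncard B.ncard + (4 * Δ) ^ (ℓ + 1) := by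
  have h1 := cw_peak G ℓ Δ A B hAB hcover hbip hΔ hgirth v
  have h2 := (cwR_bound G ℓ Δ A B hAB hbip hΔ hgirth v (2 * ℓ + 2) v (Reachable.refl _)
    (by simp)).2
  have e : 2 ^ (2 * ℓ + 2) * Δ ^ ((2 * ℓ + 2 - G.dist v v) / 2) = (4 * Δ) ^ (ℓ + 1) := by
    rw [SimpleGraph.dist_self, show (2 * ℓ + 2 - 0) / 2 = ℓ + 1 by omega, mul_pow,
      show 2 * ℓ + 2 = 2 * (ℓ + 1) by ring, pow_mul]
    norm_num
  rw [e] at h2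
  refine le_trans ?_ (Nat.add_le_add h1 h2)
  refine le_trans (Set.ncard_le_ncard ?_ (Set.toFinite _)) (Set.ncard_union_le _ _)
  intro f hf
  by_cases hm : G.dist v (cwExt f (ℓ + 1)) = ℓ + 1
  · exact Or.inl ⟨hf, hm⟩
  · refine Or.inr ⟨hf.1, hf.2.1, hf.2.2, ?_⟩
    obtain ⟨g0, g1, g2⟩ := hf
    have hadj := cwExt_adj G f g2
    have e0 : cwExt f 0 = v := g0
    have e1 : cwExt f (2 * ℓ + 2) = v := by
      rw [cwExt_apply f _ (by omega)]; exact g1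
    obtain ⟨r, d1, d2⟩ := cw_seq_dist G v _ (cwExt f) hadj (by rw [e0])
    intro i
    have hi := i.2
    rw [← cwExt_apply f i i.2]
    have a := d1 i 0 (by omega)
    have b := d2 (2 * ℓ + 2 - i) i (by omega)
    rw [zero_add, e0, SimpleGraph.dist_self] at a
    rw [show i.1 + (2 * ℓ + 2 - i.1) = 2 * ℓ + 2 by omega, e1, SimpleGraph.dist_self] at b
    by_cases hii : i.1 = ℓ + 1
    · rw [hii] at a b ⊢; omega
    · omega
end

section
/- Let G be a graph, r ≥ 1 an integer, and k > 2r an odd integer, and suppose G contains no cycle of length k. Then for every vertex v of G with N_r(v) nonempty, the induced subgraph G[N_r(v)] has average degree less than max(6, 2k − 8), i.e. 2·e(G[N_r(v)]) < max(6, 2k − 8)·|N_r(v)|. -/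
open SimpleGraph

/-- `N_r(v)`: the set of vertices at distance exactly `r` from `v`. -/
def distSphere {V : Type*} (G : SimpleGraph V) (v : V) (r : ℕ) : Set V :=
  {u | G.Reachable v u ∧ G.dist v u = r}


namespace SphereAux

/-- `q 0, …, q n` is a path in `G` with all vertices in `S`. -/
def IsP {V : Type*} (G : SimpleGraph V) (S : Set V) (n : ℕ) (q : ℕ → V) : Prop :=
  (∀ i ≤ n, q i ∈ S) ∧ (∀ i ≤ n, ∀ j ≤ n, q i = q j → i = j) ∧ ∀ i < n, G.Adj (q i) (q (i + 1))

lemma walk_of_seq {V : Type*} (G : SimpleGraph V) (n : ℕ) : ∀ (q : ℕ → V),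
    (∀ i ≤ n, ∀ j ≤ n, q i = q j → i = j) → (∀ i < n, G.Adj (q i) (q (i + 1))) →
    ∃ w : G.Walk (q 0) (q n), w.IsPath ∧ w.length = n ∧ (∀ x ∈ w.support, ∃ i ≤ n, x = q i) ∧
      ∀ e ∈ w.edges, ∃ i < n, e = s(q i, q (i + 1)) := by
  induction n with
  | zero =>
    intro q _ _
    exact ⟨Walk.nil, by simp, by simp, by simp, by simp⟩
  | succ n ih =>
    intro q hinj hadj
    obtain ⟨w, hp, hl, hs, he⟩ := ih (fun i => q (i + 1))
      (fun i hi j hj h => by have := hinj (i+1) (by omega) (j+1) (by omega) h; omega)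
      (fun i hi => hadj (i+1) (by omega))
    refine ⟨Walk.cons (hadj 0 (by omega)) w, ?_, by simp [hl], ?_, ?_⟩
    · rw [Walk.cons_isPath_iff]
      refine ⟨hp, fun hmem => ?_⟩
      obtain ⟨i, hi, h⟩ := hs _ hmem
      have := hinj 0 (by omega) (i+1) (by omega) h
      omega
    · intro x hx
      rw [Walk.support_cons, List.mem_cons] at hx
      rcases hx with rfl | hx
      · exact ⟨0, by omega, rfl⟩
      · obtain ⟨i, hi, h⟩ := hs _ hx
        exact ⟨i+1, by omega, h⟩
    · intro e hx
      rw [Walk.edges_cons, List.mem_cons] at hx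
      rcases hx with rfl | hx
      · exact ⟨0, by omega, rfl⟩
      · obtain ⟨i, hi, h⟩ := he _ hx
        exact ⟨i+1, by omega, h⟩

lemma hasCycle_of_seq {V : Type*} (G : SimpleGraph V) (n : ℕ) (hn : 2 ≤ n) (q : ℕ → V)
    (hinj : ∀ i ≤ n, ∀ j ≤ n, q i = q j → i = j) (hadj : ∀ i < n, G.Adj (q i) (q (i + 1)))
    (hc : G.Adj (q n) (q 0)) : HasCycleLength G (n + 1) := by
  obtain ⟨w, hp, hl, hs, he⟩ := walk_of_seq G n q hinj hadj
  refine ⟨q n, Walk.cons hc w, ?_, by simp [hl]⟩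
  rw [Walk.cons_isCycle_iff]
  refine ⟨hp, fun hmem => ?_⟩
  obtain ⟨i, hi, h⟩ := he _ hmem
  rw [Sym2.eq_iff] at h
  rcases h with ⟨h1, h2⟩ | ⟨h1, h2⟩
  · have := hinj _ (by omega) _ (by omega) h1
    omega
  · have := hinj _ (by omega) _ (by omega) h1
    have := hinj _ (by omega) _ (by omega) h2
    omega

lemma exists_parent {V : Type*} (G : SimpleGraph V) (v : V) : ∃ p : V → V,
    ∀ x, G.Reachable v x → G.dist v x ≠ 0 →
      G.Adj x (p x) ∧ G.Reachable v (p x) ∧ G.dist v (p x) + 1 = G.dist v x := by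
  have key : ∀ x, ∃ y, G.Reachable v x → G.dist v x ≠ 0 →
      G.Adj x y ∧ G.Reachable v y ∧ G.dist v y + 1 = G.dist v x := by
    intro x
    by_cases hx : G.Reachable v x ∧ G.dist v x ≠ 0
    · obtain ⟨hr, h0⟩ := hx
      obtain ⟨w, hw⟩ := hr.symm.exists_walk_length_eq_dist
      rw [SimpleGraph.dist_comm] at hw
      cases w with
      | nil => simp at h0
      | @cons _ y _ h w' =>
        refine ⟨y, fun _ _ => ⟨h, ⟨w'.reverse⟩, ?_⟩⟩
        have h1 : G.dist v y ≤ w'.length := by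
          rw [SimpleGraph.dist_comm]; exact SimpleGraph.dist_le w'
        have hry : G.Reachable v y := ⟨w'.reverse⟩
        obtain ⟨u, hu⟩ := hry.exists_walk_length_eq_dist
        have h2 : G.dist v x ≤ (u.concat h.symm).length := SimpleGraph.dist_le _
        rw [Walk.length_concat] at h2
        rw [Walk.length_cons] at hw
        omega
    · exact ⟨x, fun a b => (hx ⟨a, b⟩).elim⟩
  choose p hp using key
  exact ⟨p, hp⟩

lemma iter_parent {V : Type*} (G : SimpleGraph V) (v : V) (p : V → V)
    (hp : ∀ x, G.Reachable v x → G.dist v x ≠ 0 →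
      G.Adj x (p x) ∧ G.Reachable v (p x) ∧ G.dist v (p x) + 1 = G.dist v x)
    (r : ℕ) (x : V) (hx : x ∈ distSphere G v r) (i : ℕ) (hi : i ≤ r) :
    G.Reachable v (p^[i] x) ∧ G.dist v (p^[i] x) + i = r := by
  induction i with
  | zero => exact ⟨hx.1, hx.2⟩
  | succ i ih =>
    obtain ⟨h1, h2⟩ := ih (by omega)
    obtain ⟨_, h4, h5⟩ := hp _ h1 (by omega)
    rw [Function.iterate_succ_apply']
    exact ⟨h4, by omega⟩

/-- Closing up a path inside a sphere through the search tree. -/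
lemma close_up {V : Type*} (G : SimpleGraph V) (v : V) (p : V → V)
    (hp : ∀ x, G.Reachable v x → G.dist v x ≠ 0 →
      G.Adj x (p x) ∧ G.Reachable v (p x) ∧ G.dist v (p x) + 1 = G.dist v x)
    (r s l : ℕ) (hs1 : s + 1 ≤ r) (hl : 1 ≤ l) (q : ℕ → V) (hq : IsP G (distSphere G v r) l q)
    (heq : p^[s+1] (q 0) = p^[s+1] (q l)) (hne : p^[s] (q 0) ≠ p^[s] (q l)) :
    HasCycleLength G (l + 2 * (s + 1)) := by
  obtain ⟨hS, hinj, hadj⟩ := hq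
  have lev : ∀ i ≤ l, ∀ j ≤ r, G.dist v (p^[j] (q i)) + j = r := fun i hi j hj =>
    (iter_parent G v p hp r _ (hS i hi) j hj).2
  have lev0 : ∀ i ≤ l, G.dist v (q i) = r := fun i hi => (hS i hi).2
  have adj' : ∀ i ≤ l, ∀ j < r, G.Adj (p^[j] (q i)) (p^[j+1] (q i)) := by
    intro i hi j hj
    have := iter_parent G v p hp r _ (hS i hi) j hj.le
    rw [Function.iterate_succ_apply']
    exact (hp _ this.1 (by omega)).1
  have ne' : ∀ j ≤ s, p^[j] (q 0) ≠ p^[j] (q l) := by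
    intro j hj h
    apply hne
    obtain ⟨t, rfl⟩ := Nat.exists_eq_add_of_le hj
    rw [add_comm, Function.iterate_add_apply, Function.iterate_add_apply, h]
  let Q : ℕ → V := fun t => if t ≤ l then q t else if t ≤ l + s + 1 then p^[t - l] (q l)
    else p^[l + 2 * (s+1) - t] (q 0)
  have Q1 : ∀ t ≤ l, Q t = q t := fun t ht => by simp [Q, ht]
  have Q2 : ∀ j, j ≤ s + 1 → Q (l + j) = p^[j] (q l) := by
    intro j hj
    by_cases h0 : j = 0
    · subst h0; simp [Q]
    · have : ¬ (l + j ≤ l) := by omega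
      have h2 : l + j ≤ l + s + 1 := by omega
      simp only [Q]
      rw [if_neg this, if_pos h2]
      congr 2
      omega
  have Q3 : ∀ j, 1 ≤ j → j ≤ s + 1 → Q (l + 2 * (s+1) - j) = p^[j] (q 0) := by
    intro j hj hj'
    by_cases h0 : j = s + 1
    · subst h0
      rw [heq, ← Q2 _ le_rfl]
      congr 1
      omega
    · have h1 : ¬ (l + 2 * (s+1) - j ≤ l) := by omega
      have h2 : ¬ (l + 2 * (s+1) - j ≤ l + s + 1) := by omega
      simp only [Q]
      rw [if_neg h1, if_neg h2]
      congr 2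
      omega
  have cases3 : ∀ t ≤ l + 2 * s + 1, (t ≤ l) ∨ (∃ j, 1 ≤ j ∧ j ≤ s + 1 ∧ t = l + j) ∨
      ∃ j, 1 ≤ j ∧ j ≤ s ∧ t = l + 2 * (s+1) - j := by
    intro t ht
    by_cases h1 : t ≤ l
    · exact Or.inl h1
    by_cases h2 : t ≤ l + s + 1
    · exact Or.inr (Or.inl ⟨t - l, by omega, by omega, by omega⟩)
    · exact Or.inr (Or.inr ⟨l + 2 * (s+1) - t, by omega, by omega, by omega⟩)
  have := hasCycle_of_seq G (l + 2 * s + 1) (by omega) Q ?_ ?_ ?_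
  · exact this
  · intro i hi j hj h
    rcases cases3 i hi with h1 | ⟨a, ha, ha', rfl⟩ | ⟨a, ha, ha', rfl⟩ <;>
    rcases cases3 j hj with h2 | ⟨b, hb, hb', rfl⟩ | ⟨b, hb, hb', rfl⟩
    · rw [Q1 _ h1, Q1 _ h2] at h
      exact hinj _ h1 _ h2 h
    · rw [Q1 _ h1, Q2 _ hb'] at h
      have e1 := lev0 i h1
      have e2 := lev l le_rfl b (by omega)
      rw [← h] at e2
      omega
    · rw [Q1 _ h1, Q3 _ hb (by omega)] at h
      have e1 := lev0 i h1
      have e2 := lev 0 (by omega) b (by omega)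
      rw [← h] at e2
      omega
    · rw [Q1 _ h2, Q2 _ ha'] at h
      have e1 := lev0 j h2
      have e2 := lev l le_rfl a (by omega)
      rw [h] at e2
      omega
    · rw [Q2 _ ha', Q2 _ hb'] at h
      have e1 := lev l le_rfl b (by omega)
      have e2 := lev l le_rfl a (by omega)
      rw [h] at e2
      omega
    · rw [Q2 _ ha', Q3 _ hb (by omega)] at h
      have e1 := lev 0 (by omega) b (by omega)
      have e2 := lev l le_rfl a (by omega)
      rw [h] at e2
      have : a = b := by omega
      subst this
      exact (ne' a (by omega) h.symm).elim
    · rw [Q1 _ h2, Q3 _ ha (by omega)] at h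
      have e1 := lev0 j h2
      have e2 := lev 0 (by omega) a (by omega)
      rw [h] at e2
      omega
    · rw [Q2 _ hb', Q3 _ ha (by omega)] at h
      have e1 := lev 0 (by omega) a (by omega)
      have e2 := lev l le_rfl b (by omega)
      rw [← h] at e2
      have : a = b := by omega
      subst this
      exact (ne' a (by omega) h).elim
    · rw [Q3 _ ha (by omega), Q3 _ hb (by omega)] at h
      have e1 := lev 0 (by omega) a (by omega)
      have e2 := lev 0 (by omega) b (by omega)
      rw [← h] at e2
      omega
  · intro i hi
    by_cases h1 : i < l
    · rw [Q1 i (by omega), Q1 (i+1) (by omega)]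
      exact hadj i h1
    by_cases h2 : i ≤ l + s
    · obtain ⟨j, rfl⟩ := Nat.exists_eq_add_of_le (not_lt.mp h1)
      rw [Q2 j (by omega), add_assoc, Q2 (j+1) (by omega)]
      exact adj' l le_rfl j (by omega)
    · obtain ⟨j, hj⟩ : ∃ j, j = l + 2 * (s+1) - (i + 1) := ⟨_, rfl⟩
      have e1 : i = l + 2 * (s+1) - (j + 1) := by omega
      have e2 : i + 1 = l + 2 * (s+1) - j := by omega
      rw [e2, Q3 j (by omega) (by omega), e1, Q3 (j+1) (by omega) (by omega)]
      exact (adj' 0 (by omega) j (by omega)).symm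
  · have e : l + 2 * s + 1 = l + 2 * (s+1) - 1 := by omega
    rw [e, Q3 1 le_rfl (by omega), Q1 0 (by omega)]
    exact (adj' 0 (by omega) 0 (by omega)).symm


/-- The cycle-with-chord lemma. -/
lemma theta {V α : Type*} (G : SimpleGraph V) (S : Set V) (y : ℤ → V) (m J : ℤ) (l : ℕ)
    (hyS : ∀ i, y i ∈ S)
    (hy : ∀ i j, y i = y j ↔ m ∣ i - j) (hadj : ∀ i, G.Adj (y i) (y (i + 1)))
    (hJ2 : 2 ≤ J) (hJm : J + 2 ≤ m) (hch : G.Adj (y 0) (y J)) (hlo : Odd l) (hlm : (l : ℤ) < m)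
    (f : V → α) (H : ∀ q : ℕ → V, IsP G S l q → f (q 0) = f (q l)) :
    ∀ i j, f (y i) = f (y j) := by
  have hl1 : 1 ≤ l := hlo.pos
  have nd : ∀ t : ℤ, m ∣ t → |t| < m → t = 0 := fun t h1 h2 => Int.eq_zero_of_abs_lt_dvd h1 h2
  obtain ⟨c, hc⟩ : ∃ c : ℤ → α, ∀ i, c i = f (y i) := ⟨_, fun _ => rfl⟩
  have hcm : ∀ x, c (x + m) = c x := by
    intro x
    rw [hc, hc, (hy (x + m) x).2 (by simp)]
  have hcl : ∀ x, c (x + l) = c x := by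
    intro x
    have := H (fun i => y (x + i)) ⟨fun i _ => hyS _, ?_, ?_⟩
    · simp only [hc]
      simpa using this.symm
    · intro i hi j hj h
      have h1 := nd _ ((hy _ _).1 h) (by rw [abs_lt]; constructor <;> omega)
      omega
    · intro i hi
      have := hadj (x + i)
      push_cast
      rwa [add_assoc] at this
  -- paths using the chord
  have chord : ∀ e e' : ℤ, (e = 1 ∨ e = -1) → (e' = 1 ∨ e' = -1) → ∀ a : ℕ, a < l →
      (∀ i j : ℤ, 0 ≤ i → i ≤ a → 0 ≤ j → j ≤ l - 1 - a → ¬ m ∣ e * i - (J + e' * j)) →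
      c (e * a) = c (J + e' * (l - 1 - a)) := by
    intro e e' he he' a ha hdis
    have hadj' : ∀ e : ℤ, (e = 1 ∨ e = -1) → ∀ t, G.Adj (y t) (y (t + e)) := by
      rintro e (rfl | rfl) t
      · exact hadj t
      · have := hadj (t + -1)
        rw [neg_add_cancel_right] at this
        exact this.symm
    let q : ℕ → V := fun i => if i ≤ a then y (e * (a - i)) else y (J + e' * (i - a - 1))
    have q1 : ∀ i ≤ a, q i = y (e * (a - i)) := fun i hi => by simp [q, hi]
    have q2 : ∀ i, a < i → q i = y (J + e' * (i - a - 1)) := fun i hi => by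
      simp [q, not_le.2 hi]
    have := H q ⟨?_, ?_, ?_⟩
    · rw [q1 0 (by omega), q2 l ha] at this
      rw [hc, hc]
      convert this using 3
      · simp
      · ring
    · intro i _
      by_cases h : i ≤ a
      · rw [q1 i h]; exact hyS _
      · rw [q2 i (by omega)]; exact hyS _
    · intro i hi j hj h
      by_cases h1 : i ≤ a <;> by_cases h2 : j ≤ a
      · rw [q1 i h1, q1 j h2, hy] at h
        have := nd _ h (by rw [abs_lt]; rcases he with rfl | rfl <;> constructor <;> omega)
        rcases he with rfl | rfl <;> omega
      · rw [q1 i h1, q2 j (by omega), hy] at h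
        exact (hdis _ _ (by omega) (by omega) (by omega) (by omega) h).elim
      · rw [q1 j h2, q2 i (by omega)] at h
        have h := (hy _ _).1 h.symm
        exact (hdis _ _ (by omega) (by omega) (by omega) (by omega) h).elim
      · rw [q2 i (by omega), q2 j (by omega), hy] at h
        have := nd _ h (by rw [abs_lt]; rcases he' with rfl | rfl <;> constructor <;> omega)
        rcases he' with rfl | rfl <;> omega
    · intro i hi
      by_cases h1 : i < a
      · rw [q1 i h1.le, q1 (i+1) h1]
        have := (hadj' e he (e * (a - (i + 1)))).symm
        convert this using 2
        · ring
        · push_cast; ring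
      by_cases h2 : i = a
      · subst h2
        rw [q1 i le_rfl, q2 (i+1) (by omega)]
        convert hch using 2
        · ring
        · push_cast; ring
      · rw [q2 i (by omega), q2 (i+1) (by omega)]
        have := hadj' e' he' (J + e' * (i - a - 1))
        convert this using 2
        push_cast; ring
  -- minimal period
  have hex : ∃ g : ℕ, 0 < g ∧ ∀ x, c (x + g) = c x := ⟨l, hl1, hcl⟩
  classical
  obtain ⟨g, ⟨hg0, hg⟩, hmin⟩ : ∃ g : ℕ, (0 < g ∧ ∀ x, c (x + g) = c x) ∧
      ∀ t : ℕ, 0 < t → (∀ x, c (x + t) = c x) → g ≤ t :=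
    ⟨Nat.find hex, Nat.find_spec hex, fun t h1 h2 => Nat.find_min' hex ⟨h1, h2⟩⟩
  have hgn : ∀ (n : ℕ) x, c (x + g * n) = c x := by
    intro n
    induction n with
    | zero => simp
    | succ n ih =>
      intro x
      have : x + g * ((n + 1 : ℕ) : ℤ) = (x + g * n) + g := by push_cast; ring
      rw [this, hg, ih]
  have hgz : ∀ (n : ℤ) x, c (x + g * n) = c x := by
    intro n x
    obtain ⟨k, rfl | rfl⟩ := n.eq_nat_or_neg
    · exact hgn k x
    · rw [← hgn k (x + g * -k)]
      congr 1; ring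
  have hgd : ∀ x z, (g : ℤ) ∣ z - x → c x = c z := by
    rintro x z ⟨n, hn⟩
    rw [← hgz n x, ← hn]
    congr 1; ring
  have hdiv : ∀ t : ℤ, (∀ x, c (x + t) = c x) → (g : ℤ) ∣ t := by
    intro t ht
    by_contra hnd
    have h0 : 0 < t % g := by
      rcases (Int.emod_nonneg t (by omega : (g : ℤ) ≠ 0)).lt_or_eq with h | h
      · exact h
      · exact (hnd (Int.dvd_of_emod_eq_zero h.symm)).elim
    have h1 : t % g < g := Int.emod_lt_of_pos _ (by omega)
    have := hmin (t % g).toNat (by omega) (by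
      intro x
      rw [Int.toNat_of_nonneg h0.le, ← ht x]
      apply hgd
      refine ⟨t / g, ?_⟩
      have := Int.emod_add_mul_ediv t g
      linarith)
    omega
  have gl := hdiv l hcl
  have gm := hdiv m hcm
  have gle : (g : ℤ) ≤ l := Int.le_of_dvd (by omega) gl
  have gml : (g : ℤ) ≤ m - l := Int.le_of_dvd (by omega) (dvd_sub gm gl)
  -- representatives
  have rep : ∀ (A x : ℤ), ∃ a, A ≤ a ∧ a ≤ A + g - 1 ∧ (g : ℤ) ∣ a - x := by
    intro A x
    refine ⟨A + (x - A) % g, ?_, ?_, ?_⟩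
    · have := Int.emod_nonneg (x - A) (by omega : (g : ℤ) ≠ 0)
      omega
    · have := Int.emod_lt_of_pos (x - A) (by omega : (0 : ℤ) < g)
      omega
    · refine ⟨-((x - A) / g), ?_⟩
      have := Int.emod_add_mul_ediv (x - A) g
      linarith
  suffices hone : g = 1 by
    intro i j
    rw [← hc, ← hc]
    apply hgd
    simp [hone]
  by_cases hJg : J < g
  · exfalso
    have := hdiv (J - 1) (by
      intro x
      obtain ⟨a, ha0, ha1, ha⟩ := rep 0 (-x)
      lift a to ℕ using ha0
      have h3 := chord (-1) 1 (Or.inr rfl) (Or.inl rfl) a (by omega) (by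
        intro i j hi hi' hj hj' hd
        have := nd _ hd (by rw [abs_lt]; constructor <;> omega)
        omega)
      rw [hgd x (-1 * a) (by rw [show -1 * (a : ℤ) - x = -(a - -x) by ring]; exact (dvd_neg).2 ha), h3]
      apply hgd
      have : J + 1 * ((l : ℤ) - 1 - a) - (x + (J - 1)) = l - (a - -x) := by ring
      rw [this]
      exact dvd_sub gl ha)
    have := Int.le_of_dvd (by omega) this
    omega
  by_cases hJg' : m - J < g
  · exfalso
    have := hdiv (J + 1) (by
      intro x
      obtain ⟨a, ha0, ha1, ha⟩ := rep 0 x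
      lift a to ℕ using ha0
      have h3 := chord 1 (-1) (Or.inl rfl) (Or.inr rfl) a (by omega) (by
        intro i j hi hi' hj hj' hd
        have := nd _ hd (by rw [abs_lt]; constructor <;> omega)
        omega)
      rw [hgd x (1 * a) (by convert ha using 1; ring), h3]
      apply hgd
      have : J + -1 * ((l : ℤ) - 1 - a) - (x + (J + 1)) = (a - x) - l := by ring
      rw [this]
      exact dvd_sub ha gl)
    have := Int.le_of_dvd (by omega) (dvd_sub gm this)
    omega
  have R1 : ∀ x, c x = c (J + 1 - x) := by
    intro x
    obtain ⟨a, ha0, ha1, ha⟩ := rep (max 0 (l - J)) (-x)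
    have ha2 := le_trans (le_max_left _ _) ha0
    have ha3 := le_trans (le_max_right _ _) ha0
    have ha4 : a ≤ l - 1 ∧ a ≤ m - J - 1 := by
      rcases max_cases 0 ((l : ℤ) - J) with ⟨h, _⟩ | ⟨h, _⟩ <;> rw [h] at ha1 <;> omega
    lift a to ℕ using ha2
    have h3 := chord (-1) (-1) (Or.inr rfl) (Or.inr rfl) a (by omega) (by
      intro i j hi hi' hj hj' hd
      have := nd _ hd (by rw [abs_lt]; constructor <;> omega)
      omega)
    rw [hgd x (-1 * a) (by rw [show -1 * (a : ℤ) - x = -(a - -x) by ring]; exact (dvd_neg).2 ha), h3]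
    apply hgd
    have : J + 1 - x - (J + -1 * ((l : ℤ) - 1 - a)) = l - (a - -x) := by ring
    rw [this]
    exact dvd_sub gl ha
  have R2 : ∀ x, c x = c (J - 1 - x) := by
    intro x
    obtain ⟨a, ha0, ha1, ha⟩ := rep (max 0 (l - (m - J))) x
    have ha2 := le_trans (le_max_left _ _) ha0
    have ha3 := le_trans (le_max_right _ _) ha0
    have ha4 : a ≤ l - 1 ∧ a ≤ J - 1 := by
      rcases max_cases 0 ((l : ℤ) - (m - J)) with ⟨h, _⟩ | ⟨h, _⟩ <;> rw [h] at ha1 <;> omega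
    lift a to ℕ using ha2
    have h3 := chord 1 1 (Or.inl rfl) (Or.inl rfl) a (by omega) (by
      intro i j hi hi' hj hj' hd
      have := nd _ hd (by rw [abs_lt]; constructor <;> omega)
      omega)
    rw [hgd x (1 * a) (by convert ha using 1; ring), h3]
    apply hgd
    have : J - 1 - x - (J + 1 * ((l : ℤ) - 1 - a)) = (a - x) - l := by ring
    rw [this]
    exact dvd_sub ha gl
  have g2 := hdiv 2 (by
    intro x
    rw [R1, R2 x]
    congr 1; ring)
  have g2' : g ∣ 2 := by exact_mod_cast g2
  have gl' : g ∣ l := by exact_mod_cast gl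
  rcases (Nat.dvd_prime Nat.prime_two).1 g2' with h | h
  · exact h
  · rw [h] at gl'
    exact absurd gl' (by rw [← even_iff_two_dvd]; exact Nat.not_even_iff_odd.2 hlo)


open Classical in
/-- Degree of `x` into the finite set `S`. -/
noncomputable def dg {V : Type*} (G : SimpleGraph V) (S : Finset V) (x : V) : ℕ :=
  (S.filter (fun z => G.Adj x z)).card

open Classical in
lemma dg_union {V : Type*} (G : SimpleGraph V) (S T : Finset V) (hT : T ⊆ S) (x : V) :
    dg G S x = dg G (S \ T) x + dg G T x := by
  unfold dg
  rw [← Finset.card_union_of_disjoint, ← Finset.filter_union, Finset.sdiff_union_of_subset hT]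
  exact Finset.disjoint_filter_filter Finset.sdiff_disjoint

open Classical in
lemma sum_dg_comm {V : Type*} (G : SimpleGraph V) (S T : Finset V) :
    ∑ x ∈ S, dg G T x = ∑ x ∈ T, dg G S x := by
  unfold dg
  simp only [Finset.card_filter]
  rw [Finset.sum_comm]
  simp only [G.adj_comm]

open Classical in
lemma sum_dg_split {V : Type*} (G : SimpleGraph V) (S T : Finset V) (hT : T ⊆ S) :
    ∑ x ∈ S, dg G S x =
      ∑ x ∈ S \ T, dg G (S \ T) x + ∑ x ∈ T, (dg G S x + dg G (S \ T) x) := by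
  rw [← Finset.sum_sdiff hT, Finset.sum_congr rfl (fun x _ => dg_union G S T hT x),
    Finset.sum_add_distrib, Finset.sum_add_distrib, sum_dg_comm G (S \ T) T]
  ring

open Classical in
/-- A dense graph contains a cycle with a chord on at least `d + 3` vertices. -/
lemma exists_theta {V : Type*} (G : SimpleGraph V) (d : ℕ) (hd : 3 ≤ d) (S₀ : Finset V)
    (hne₀ : S₀.Nonempty) (hD₀ : 2 * d * S₀.card ≤ ∑ x ∈ S₀, dg G S₀ x) :
    ∃ (n J : ℕ) (x : ℕ → V), d + 2 ≤ n ∧ IsP G S₀ n x ∧ G.Adj (x 0) (x n) ∧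
      2 ≤ J ∧ J + 1 ≤ n ∧ G.Adj (x 0) (x J) := by
  by_contra hcon
  obtain ⟨S, ⟨hSS, hne, hD⟩, hmin⟩ : ∃ S : Finset V, (S ⊆ S₀ ∧ S.Nonempty ∧
      2 * d * S.card ≤ ∑ x ∈ S, dg G S x) ∧ ∀ T : Finset V, (T ⊆ S₀ ∧ T.Nonempty ∧
      2 * d * T.card ≤ ∑ x ∈ T, dg G T x) → S.card ≤ T.card := by
    obtain ⟨S, hS, hm⟩ := Finset.exists_min_image (S₀.powerset.filter (fun S => S.Nonempty ∧
      2 * d * S.card ≤ ∑ x ∈ S, dg G S x)) Finset.card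
      ⟨S₀, by simp only [Finset.mem_filter, Finset.mem_powerset]; exact ⟨subset_rfl, hne₀, hD₀⟩⟩
    simp only [Finset.mem_filter, Finset.mem_powerset] at hS hm
    exact ⟨S, hS, hm⟩
  -- minimality
  have hrem : ∀ T ⊆ S, T.Nonempty → (S \ T).Nonempty →
      2 * d * T.card < ∑ x ∈ T, (dg G S x + dg G (S \ T) x) := by
    intro T hT hTne hne'
    by_contra hle
    have h1 := sum_dg_split G S T hT
    have h2 := Finset.card_sdiff_add_card_eq_card hT
    have h3 := hmin (S \ T) ⟨Finset.sdiff_subset.trans hSS, hne', by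
      rw [← h2] at hD
      nlinarith⟩
    have := hTne.card_pos
    omega
  have hdeg : ∀ x ∈ S, d + 1 ≤ dg G S x := by
    intro x hx
    have h1 : (S \ {x}).Nonempty := by
      by_contra h
      rw [Finset.not_nonempty_iff_eq_empty, Finset.sdiff_eq_empty_iff_subset] at h
      have h2 : S = {x} := Finset.Subset.antisymm h (by simpa using hx)
      rw [h2] at hD
      simp [dg, Finset.filter_singleton] at hD
      omega
    have h2 := hrem {x} (by simpa using hx) (by simp) h1
    have h3 := dg_union G S {x} (by simpa using hx) x
    simp at h2
    omega
  -- longest path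
  obtain ⟨n, ⟨x, hx⟩, hmax⟩ : ∃ n, (∃ x, IsP G S n x) ∧ ∀ n' x', IsP G S n' x' → n' ≤ n := by
    have hb : ∀ n x, IsP G S n x → n ≤ S.card := by
      intro n x hx
      have := Finset.card_le_card_of_injOn (s := Finset.range (n+1)) (t := S) x
        (fun i hi => hx.1 i (by simp at hi; omega))
        (fun i hi j hj h => hx.2.1 i (by simp at hi; omega) j (by simp at hj; omega) h)
      simp at this
      omega
    obtain ⟨s, hs⟩ := hne
    have h0 : ∃ x, IsP G S 0 x := ⟨fun _ => s, fun _ _ => hs, by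
      intro i hi j hj _; omega, by intro i hi; omega⟩
    refine ⟨Nat.findGreatest (fun n => ∃ x, IsP G S n x) S.card, ?_, ?_⟩
    · exact Nat.findGreatest_spec (P := fun n => ∃ x, IsP G S n x) (Nat.zero_le _) h0
    · intro n' x' h
      exact Nat.le_findGreatest (hb _ _ h) ⟨x', h⟩
  -- the end of any longest path
  have hend : ∀ x, IsP G S n x → d + 1 ≤ n ∧
      S.filter (fun z => G.Adj (x 0) z) = (Finset.Icc 1 (d+1)).image x := by
    intro x hx
    have hnb : ∀ z ∈ S, G.Adj (x 0) z → ∃ i, 1 ≤ i ∧ i ≤ n ∧ x i = z := by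
      intro z hz hadj
      by_contra hno
      push Not at hno
      have hz0 : ∀ i ≤ n, x i ≠ z := by
        intro i hi
        rcases Nat.eq_zero_or_pos i with rfl | h
        · exact hadj.ne
        · exact hno i h hi
      have := hmax (n+1) (fun i => if i = 0 then z else x (i - 1)) ⟨?_, ?_, ?_⟩
      · omega
      · intro i hi
        by_cases h : i = 0
        · simpa [h] using hz
        · simpa [h] using hx.1 (i-1) (by omega)
      · intro i hi j hj h
        by_cases h1 : i = 0 <;> by_cases h2 : j = 0
        · omega
        · simp only [h1, h2, if_true, if_false] at h
          exact (hz0 _ (by omega) h.symm).elim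
        · simp only [h1, h2, if_true, if_false] at h
          exact (hz0 _ (by omega) h).elim
        · simp only [h1, h2, if_false] at h
          have := hx.2.1 _ (by omega) _ (by omega) h
          omega
      · intro i hi
        by_cases h : i = 0
        · subst h
          simpa using hadj.symm
        · have := hx.2.2 (i-1) (by omega)
          have e : i - 1 + 1 = i := by omega
          rw [e] at this
          simpa [h] using this
    obtain ⟨I, hI⟩ : ∃ I, I = (Finset.Icc 1 n).filter (fun i => G.Adj (x 0) (x i)) := ⟨_, rfl⟩
    have memI : ∀ i, i ∈ I ↔ (1 ≤ i ∧ i ≤ n) ∧ G.Adj (x 0) (x i) := by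
      intro i; simp [hI]
    have himg : S.filter (fun z => G.Adj (x 0) z) = I.image x := by
      ext z
      simp only [Finset.mem_filter, Finset.mem_image, memI]
      constructor
      · rintro ⟨hz, hadj⟩
        obtain ⟨i, h1, h2, rfl⟩ := hnb z hz hadj
        exact ⟨i, ⟨⟨h1, h2⟩, hadj⟩, rfl⟩
      · rintro ⟨i, ⟨⟨h1, h2⟩, h3⟩, rfl⟩
        exact ⟨hx.1 i h2, h3⟩
    have hcard : d + 1 ≤ I.card := by
      have := hdeg (x 0) (hx.1 0 (by omega))
      unfold dg at this
      rw [himg] at this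
      exact this.trans Finset.card_image_le
    have hIne : I.Nonempty := Finset.card_pos.1 (by omega)
    obtain ⟨j, hj, hjmax⟩ := Finset.exists_max_image I id hIne
    simp only [id] at hjmax
    have hjI := (memI j).1 hj
    have hjd : j ≤ d + 1 := by
      by_contra hlt
      apply hcon
      have : ∃ i ∈ I, i ∉ ({1, j} : Finset ℕ) := by
        apply Finset.exists_mem_notMem_of_card_lt_card
        exact lt_of_le_of_lt (Finset.card_le_two) (by omega)
      obtain ⟨i, hi, hi'⟩ := this
      have hiI := (memI i).1 hi
      have hij := hjmax i hi
      simp at hi'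
      refine ⟨j, i, x, by omega, ⟨?_, ?_, ?_⟩, hjI.2, by omega, by omega, hiI.2⟩
      · intro t ht
        exact hSS (hx.1 t (by omega))
      · intro t ht t' ht' h
        exact hx.2.1 t (by omega) t' (by omega) h
      · intro t ht
        exact hx.2.2 t (by omega)
    have hsub : I ⊆ Finset.Icc 1 (d+1) := by
      intro i hi
      have := hjmax i hi
      have := (memI i).1 hi
      rw [Finset.mem_Icc]
      omega
    have hIeq : I = Finset.Icc 1 (d+1) :=
      Finset.eq_of_subset_of_card_le hsub (by simpa using hcard)
    refine ⟨?_, by rw [himg, hIeq]⟩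
    have : d + 1 ∈ I := by rw [hIeq]; simp
    exact ((memI _).1 this).1.2
  have hdn : d + 1 ≤ n := (hend x hx).1
  -- rotations
  have hrot : ∀ i ≤ d, dg G S (x i) ≤ d + 1 ∧
      ∀ z ∈ S, G.Adj (x i) z → ∃ t ≤ d + 1, z = x t := by
    intro i hi
    let q : ℕ → V := fun t => if t ≤ i then x (i - t) else x t
    have q1 : ∀ t ≤ i, q t = x (i - t) := fun t ht => by simp [q, ht]
    have q2 : ∀ t, i < t → q t = x t := fun t ht => by simp [q, not_le.2 ht]
    have hadj0 : G.Adj (x 0) (x (i+1)) := by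
      have : x (i+1) ∈ S.filter (fun z => G.Adj (x 0) z) := by
        rw [(hend x hx).2]
        exact Finset.mem_image_of_mem _ (by simp; omega)
      exact (Finset.mem_filter.1 this).2
    have hq : IsP G S n q := by
      refine ⟨?_, ?_, ?_⟩
      · intro t ht
        by_cases h : t ≤ i
        · rw [q1 t h]; exact hx.1 _ (by omega)
        · rw [q2 t (by omega)]; exact hx.1 _ ht
      · intro t ht t' ht' h
        by_cases h1 : t ≤ i <;> by_cases h2 : t' ≤ i
        · rw [q1 t h1, q1 t' h2] at h
          have := hx.2.1 _ (by omega) _ (by omega) h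
          omega
        · rw [q1 t h1, q2 t' (by omega)] at h
          have := hx.2.1 _ (by omega) _ (by omega) h
          omega
        · rw [q2 t (by omega), q1 t' h2] at h
          have := hx.2.1 _ (by omega) _ (by omega) h
          omega
        · rw [q2 t (by omega), q2 t' (by omega)] at h
          exact hx.2.1 _ (by omega) _ (by omega) h
      · intro t ht
        by_cases h1 : t < i
        · rw [q1 t h1.le, q1 (t+1) h1]
          have := hx.2.2 (i - (t+1)) (by omega)
          rw [show i - (t+1) + 1 = i - t by omega] at this
          exact this.symm
        by_cases h2 : t = i
        · rw [q1 t (by omega), q2 (t+1) (by omega), h2, Nat.sub_self]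
          exact hadj0
        · rw [q2 t (by omega), q2 (t+1) (by omega)]
          exact hx.2.2 t ht
    have hq0 : q 0 = x i := by rw [q1 0 (by omega)]; simp
    have hE := (hend q hq).2
    rw [hq0] at hE
    constructor
    · unfold dg
      rw [hE]
      exact Finset.card_image_le.trans (by simp)
    · intro z hz hadj
      have : z ∈ S.filter (fun z => G.Adj (x i) z) := Finset.mem_filter.2 ⟨hz, hadj⟩
      rw [hE, Finset.mem_image] at this
      obtain ⟨t, ht, rfl⟩ := this
      rw [Finset.mem_Icc] at ht
      by_cases h : t ≤ i
      · exact ⟨i - t, by omega, q1 t h⟩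
      · exact ⟨t, by omega, q2 t (by omega)⟩
  obtain ⟨T, hTdef⟩ : ∃ T, T = (Finset.range (d+1)).image x := ⟨_, rfl⟩
  have hTS : T ⊆ S := by
    intro z hz
    rw [hTdef, Finset.mem_image] at hz
    obtain ⟨i, hi, rfl⟩ := hz
    rw [Finset.mem_range] at hi
    exact hx.1 i (by omega)
  have hTc : T.card = d + 1 := by
    rw [hTdef, Finset.card_image_of_injOn, Finset.card_range]
    intro i hi j hj h
    simp at hi hj
    exact hx.2.1 i (by omega) j (by omega) h
  have hlast : x (d+1) ∈ S \ T := by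
    rw [Finset.mem_sdiff]
    refine ⟨hx.1 _ hdn, ?_⟩
    rw [hTdef, Finset.mem_image]
    rintro ⟨i, hi, h⟩
    rw [Finset.mem_range] at hi
    have := hx.2.1 _ (by omega) _ hdn h
    omega
  have hfin := hrem T hTS (Finset.card_pos.1 (by omega)) ⟨_, hlast⟩
  have hle : ∑ z ∈ T, (dg G S z + dg G (S \ T) z) ≤ ∑ z ∈ T, (d + 2) := by
    apply Finset.sum_le_sum
    intro z hz
    rw [hTdef, Finset.mem_image] at hz
    obtain ⟨i, hi, rfl⟩ := hz
    rw [Finset.mem_range] at hi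
    obtain ⟨h1, h2⟩ := hrot i (by omega)
    have h3 : dg G (S \ T) (x i) ≤ 1 := by
      unfold dg
      have : (S \ T).filter (fun z => G.Adj (x i) z) ⊆ {x (d+1)} := by
        intro w hw
        rw [Finset.mem_filter, Finset.mem_sdiff] at hw
        obtain ⟨t, ht, rfl⟩ := h2 w hw.1.1 hw.2
        rcases ht.lt_or_eq with h | h
        · exact (hw.1.2 (by rw [hTdef]; exact Finset.mem_image_of_mem _ (by simpa using h))).elim
        · simp [h]
      exact (Finset.card_le_card this).trans (by simp)
    omega
  rw [Finset.sum_const, smul_eq_mul, hTc] at hle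
  rw [hTc] at hfin
  nlinarith

open Classical in
lemma two_edges {V : Type*} [Fintype V] (G : SimpleGraph V) (s : Set V) :
    2 * (G.induce s).edgeSet.ncard = ∑ x ∈ s.toFinset, dg G s.toFinset x := by
  rw [Set.ncard_eq_toFinset_card', ← edgeFinset, ← sum_degrees_eq_twice_card_edges]
  rw [← Finset.sum_coe_sort s.toFinset]
  refine Fintype.sum_equiv (Equiv.subtypeEquivRight (by simp)) _ _ ?_
  intro x
  unfold dg
  rw [← card_neighborFinset_eq_degree]
  refine Finset.card_bij (fun (z : s) _ => (z : V)) ?_ ?_ ?_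
  · intro z hz
    rw [mem_neighborFinset] at hz
    simp only [Finset.mem_filter, Set.mem_toFinset]
    exact ⟨z.2, hz⟩
  · intro a _ b _ h
    exact Subtype.ext h
  · intro b hb
    simp only [Finset.mem_filter, Set.mem_toFinset] at hb
    exact ⟨⟨b, hb.1⟩, by rw [mem_neighborFinset]; exact hb.2, rfl⟩

end SphereAux

/-- If `G` contains no cycle of length `k` for odd `k > 2r`, then `G[N_r(v)]`
has average degree less than `max(6, 2k − 8)`. -/
theorem sphere_average_degree_bound {V : Type*} [Fintype V] (G : SimpleGraph V)
    (r k : ℕ) (hr : 1 ≤ r) (hk : Odd k) (hkr : 2 * r < k)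
    (hfree : ¬ HasCycleLength G k) (v : V) (hne : (distSphere G v r).Nonempty) :
    2 * (G.induce (distSphere G v r)).edgeSet.ncard <
      max 6 (2 * k - 8) * (distSphere G v r).ncard := by

  classical
  by_contra hlt
  rw [not_lt, SphereAux.two_edges, Set.ncard_eq_toFinset_card'] at hlt
  obtain ⟨d, hd⟩ : ∃ d, d = max 3 (k - 4) := ⟨_, rfl⟩
  have hd3 : 3 ≤ d := hd ▸ le_max_left _ _
  have hdk : k ≤ d + 4 := by have : k - 4 ≤ d := hd ▸ le_max_right _ _; omega
  have hd2 : 2 * d = max 6 (2 * k - 8) := by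
    rw [hd]; omega
  rw [← hd2] at hlt
  obtain ⟨n, J, x, hn, ⟨hxS, hxinj, hxadj⟩, hcyc, hJ2, hJn, hJ⟩ :=
    SphereAux.exists_theta G d hd3 _ (by simpa using hne) hlt
  simp only [Set.coe_toFinset] at hxS
  obtain ⟨p, hp⟩ := SphereAux.exists_parent G v
  -- the least level at which the tree paths merge
  have hroot : ∀ i ≤ n, p^[r] (x i) = v := by
    intro i hi
    obtain ⟨h1, h2⟩ := SphereAux.iter_parent G v p hp r _ (hxS i hi) r le_rfl
    have h3 : G.dist v (p^[r] (x i)) = 0 := by omega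
    exact (h1.dist_eq_zero_iff.1 h3).symm
  have hex : ∃ t, ∀ i ≤ n, p^[t] (x i) = p^[t] (x 0) :=
    ⟨r, fun i hi => by rw [hroot i hi, hroot 0 (by omega)]⟩
  obtain ⟨s', hs', hsmin⟩ : ∃ t, (∀ i ≤ n, p^[t] (x i) = p^[t] (x 0)) ∧
      ∀ u, (∀ i ≤ n, p^[u] (x i) = p^[u] (x 0)) → t ≤ u :=
    ⟨Nat.find hex, Nat.find_spec hex, fun u hu => Nat.find_min' hex hu⟩
  have hsr : s' ≤ r := hsmin r (fun i hi => by rw [hroot i hi, hroot 0 (by omega)])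
  cases s' with
  | zero =>
    have := hxinj _ (by omega) _ (by omega) (hs' 1 (by omega))
    omega
  | succ s =>
    obtain ⟨l, hl⟩ : ∃ l, k = l + 2 * (s + 1) := ⟨k - 2 * (s+1), by omega⟩
    have hlo : Odd l := by
      rw [hl] at hk
      by_contra h
      rw [Nat.not_odd_iff_even] at h
      exact (Nat.not_odd_iff_even.2 (h.add (even_two_mul _))) hk
    have hm0 : (0 : ℤ) < (n : ℤ) + 1 := by omega
    obtain ⟨idx, hidx⟩ : ∃ idx : ℤ → ℕ, ∀ i, idx i ≤ n ∧ (idx i : ℤ) = i % ((n : ℤ) + 1) :=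
      ⟨fun i => (i % ((n : ℤ) + 1)).toNat, fun i => by
        have h1 := Int.emod_nonneg i hm0.ne'
        have h2 := Int.emod_lt_of_pos i hm0
        constructor <;> dsimp only <;> omega⟩
    have hidx' : ∀ t : ℕ, t ≤ n → idx t = t := by
      intro t ht
      have h1 := (hidx t).2
      rw [Int.emod_eq_of_lt (by omega) (by omega)] at h1
      omega
    have key := SphereAux.theta G {z | z ∈ distSphere G v r ∧ p^[s+1] z = p^[s+1] (x 0)}
      (fun i => x (idx i)) (n + 1) J l
      (fun i => ⟨hxS _ (hidx i).1, hs' _ (hidx i).1⟩) ?_ ?_ (by omega) (by omega) ?_ hlo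
      (by omega) (fun z => p^[s] z) ?_
    · have := hsmin s (fun i hi => by
        have := key i 0
        have h0 := hidx' 0 (by omega)
        simp only [hidx' i hi] at this
        rw [this]
        simp only [Nat.cast_zero] at h0
        rw [h0])
      omega
    · intro i j
      rw [← Int.emod_eq_emod_iff_emod_sub_eq_zero.trans (Int.dvd_iff_emod_eq_zero).symm]
      rw [← (hidx i).2, ← (hidx j).2]
      constructor
      · intro h
        exact_mod_cast hxinj _ (hidx i).1 _ (hidx j).1 h
      · intro h
        have : idx i = idx j := by exact_mod_cast h
        simp only [this]
    · intro i
      have h1 := (hidx i).2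
      have h2 := (hidx (i+1)).2
      have h3 := (hidx i).1
      rw [Int.add_emod, ← h1] at h2
      rw [Int.emod_eq_of_lt (by omega : (0:ℤ) ≤ 1) (by omega)] at h2
      by_cases h : idx i = n
      · rw [h, Int.emod_self] at h2
        have : idx (i+1) = 0 := by omega
        simp only [this, h]
        exact hcyc.symm
      · rw [Int.emod_eq_of_lt (by omega) (by omega)] at h2
        have : idx (i+1) = idx i + 1 := by omega
        simp only [this]
        exact hxadj _ (by omega)
    · have h0 := hidx' 0 (by omega)
      simp only [Nat.cast_zero] at h0
      simp only [h0, hidx' J (by omega)]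
      exact hJ
    · intro q hq
      by_contra hneq
      apply hfree
      rw [hl]
      refine SphereAux.close_up G v p hp r s l hsr hlo.pos q
        ⟨fun i hi => (hq.1 i hi).1, hq.2.1, hq.2.2⟩ ?_ hneq
      rw [(hq.1 0 (by omega)).2, (hq.1 l le_rfl).2]
end
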